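/- arXiv:2310.00806 — 6 statements merged into one kernel-verified Lean document; each statement's English description precedes it below -/
import Mathlib

section
/- Bounding AIR by the information ratio: for every η > 0, every q ∈ Δ(Π) with q(π) > 0 for all π, every p ∈ Δ(Π), and every belief ν ∈ Δ(𝓜×Π) whose information gain I(ν,p) := Σ_{M,π̄,π,o} ν(M,π̄)·p(π)·[M(π)](o)·KL(ν_{π*|π,o}, ν_{π*}) is strictly positive, one has AIR_{q,η}(p,ν) ≤ (η/4)·IR(ν,p), where the information ratio is IR(ν,p) := ( Σ_{M,π̄,π} ν(M,π̄)·p(π)·(f_M(π̄) − f_M(π)) )² / I(ν,p). -/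
open Finset

/-- The probability simplex on a finite set. -/
def IsProb {S : Type*} [Fintype S] (p : S → ℝ) : Prop :=
  (∀ x, 0 ≤ p x) ∧ ∑ x, p x = 1

/-- KL divergence between probability vectors on a finite set, real-valued formula
`Σ_x p(x)·log(p(x)/q(x))`; the convention `0·log(0/y) = 0` is automatic since
`0 * _ = 0` in `ℝ`. -/
noncomputable def KLr {S : Type*} [Fintype S] (p q : S → ℝ) : ℝ :=
  ∑ x, p x * Real.log (p x / q x)

/-- Marginal distribution of the optimal decision `π*` under a belief `ν ∈ Δ(𝓜×Π)`. -/
noncomputable def margPi {M P : Type*} [Fintype M] [Fintype P] (ν : M × P → ℝ) : P → ℝ :=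
  fun π' => ∑ m, ν (m, π')

/-- `m_ν(π,o) = Σ_{M,π'} ν(M,π')·[M(π)](o)`, the probability of observing `o`
after playing `π`, under belief `ν` with observation kernels `Mo`. -/
noncomputable def mObs {M P O : Type*} [Fintype M] [Fintype P] [Fintype O]
    (Mo : M → P → O → ℝ) (ν : M × P → ℝ) (π : P) (o : O) : ℝ :=
  ∑ x : M × P, ν x * Mo x.1 π o

/-- Marginal posterior of `π*` given `(π,o)` under belief `ν`:
`ν_{π*|π,o}(π̄) = Σ_M ν(M,π̄)·[M(π)](o) / m_ν(π,o)` (Lean's `x/0 = 0` convention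
harmlessly handles the zero-probability case, whose summands carry zero weight). -/
noncomputable def post {M P O : Type*} [Fintype M] [Fintype P] [Fintype O]
    (Mo : M → P → O → ℝ) (ν : M × P → ℝ) (π : P) (o : O) : P → ℝ :=
  fun π' => (∑ m, ν (m, π') * Mo m π o) / mObs Mo ν π o

/-- Algorithmic Information Ratio
`AIR_{q,η}(p,ν) = Σ_{M,π̄,π,o} ν(M,π̄)·p(π)·[M(π)](o)·(f_M(π̄) − f_M(π) − (1/η)·KL(ν_{π*|π,o},q))`. -/
noncomputable def AIR {M P O : Type*} [Fintype M] [Fintype P] [Fintype O]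
    (Mo : M → P → O → ℝ) (f : M → P → ℝ)
    (q p : P → ℝ) (η : ℝ) (ν : M × P → ℝ) : ℝ :=
  ∑ x : M × P, ∑ π, ∑ o, ν x * p π * Mo x.1 π o *
    (f x.1 x.2 - f x.1 π - (1 / η) * KLr (post Mo ν π o) q)

section

variable {M P O : Type*} [Fintype M] [Fintype P] [Fintype O]

/-- Gibbs' inequality against a strictly positive reference distribution. -/
theorem KLr_nonneg {S : Type*} [Fintype S] {p q : S → ℝ} (hp : IsProb p) (hq : IsProb q)
    (hqpos : ∀ x, 0 < q x) : 0 ≤ KLr p q := by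
  have h : ∑ x, (p x - q x) ≤ KLr p q := by
    refine Finset.sum_le_sum fun x _ => ?_
    rcases (hp.1 x).eq_or_lt with h0 | h0
    · simp [← h0, (hqpos x).le]
    · have hl := Real.one_sub_inv_le_log_of_pos (div_pos h0 (hqpos x))
      calc p x - q x = p x * (1 - (p x / q x)⁻¹) := by
            have := (hqpos x).ne'
            field_simp
        _ ≤ _ := mul_le_mul_of_nonneg_left hl h0.le
  rw [Finset.sum_sub_distrib, hp.2, hq.2, sub_self] at h
  exact h

theorem isProb_margPi {ν : M × P → ℝ} (hν : IsProb ν) : IsProb (margPi ν) := by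
  refine ⟨fun x => Finset.sum_nonneg fun m _ => hν.1 _, ?_⟩
  unfold margPi
  rw [← hν.2, Fintype.sum_prod_type_right]

theorem mObs_mul_post {Mo : M → P → O → ℝ} (hMo : ∀ m π, IsProb (Mo m π))
    {ν : M × P → ℝ} (hν : IsProb ν) (π : P) (o : O) (b : P) :
    mObs Mo ν π o * post Mo ν π o b = ∑ m, ν (m, b) * Mo m π o := by
  unfold post
  by_cases h : mObs Mo ν π o = 0
  · have h' := (Finset.sum_eq_zero_iff_of_nonneg
      (fun x _ => mul_nonneg (hν.1 x) ((hMo x.1 π).1 o))).1 h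
    rw [h, zero_mul]
    exact (Finset.sum_eq_zero fun m _ => h' (m, b) (Finset.mem_univ _)).symm
  · field_simp

/-- A marginal posterior is absolutely continuous with respect to the prior marginal. -/
theorem post_eq_zero_of_margPi_eq_zero {Mo : M → P → O → ℝ}
    {ν : M × P → ℝ} (hν : IsProb ν) (π : P) (o : O) {b : P} (h : margPi ν b = 0) :
    post Mo ν π o b = 0 := by
  have h' := (Finset.sum_eq_zero_iff_of_nonneg (fun m _ => hν.1 (m, b))).1 h
  unfold post
  rw [Finset.sum_eq_zero fun m _ => by rw [h' m (Finset.mem_univ _), zero_mul], zero_div]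

theorem KLr_post_eq {Mo : M → P → O → ℝ} {ν : M × P → ℝ} (hν : IsProb ν)
    {q : P → ℝ} (hqpos : ∀ π, 0 < q π) (π : P) (o : O) :
    KLr (post Mo ν π o) q = KLr (post Mo ν π o) (margPi ν) +
      ∑ b, post Mo ν π o b * Real.log (margPi ν b / q b) := by
  unfold KLr
  rw [← Finset.sum_add_distrib]
  refine Finset.sum_congr rfl fun b _ => ?_
  by_cases h : post Mo ν π o b = 0
  · simp [h]
  · have hm : margPi ν b ≠ 0 := fun h0 => h (post_eq_zero_of_margPi_eq_zero hν π o h0)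
    rw [Real.log_div h (hqpos b).ne', Real.log_div h hm, Real.log_div hm (hqpos b).ne']
    ring

/-- The expected marginal posterior is the prior marginal. -/
theorem sum_post_mul_eq {Mo : M → P → O → ℝ} (hMo : ∀ m π, IsProb (Mo m π))
    {p : P → ℝ} (hp : IsProb p) {ν : M × P → ℝ} (hν : IsProb ν) (g : P → ℝ) :
    ∑ x : M × P, ∑ π, ∑ o, ν x * p π * Mo x.1 π o * ∑ b, post Mo ν π o b * g b =
      ∑ b, margPi ν b * g b := by
  have hpo : ∀ π o, ∑ x : M × P, ν x * p π * Mo x.1 π o * ∑ b, post Mo ν π o b * g b =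
      ∑ b, ∑ m, p π * (ν (m, b) * g b) * Mo m π o := by
    intro π o
    calc _ = p π * ∑ b, (mObs Mo ν π o * post Mo ν π o b) * g b := by
          simp_rw [mul_assoc (mObs Mo ν π o), ← Finset.mul_sum]
          rw [← Finset.sum_mul, ← mul_assoc]
          congr 1
          rw [mObs, Finset.mul_sum]
          exact Finset.sum_congr rfl fun x _ => by ring
      _ = _ := by
          simp_rw [mObs_mul_post hMo hν, Finset.sum_mul, Finset.mul_sum]
          exact Finset.sum_congr rfl fun b _ => Finset.sum_congr rfl fun m _ => by ring
  have hobs : ∀ π, ∑ o, ∑ b, ∑ m, p π * (ν (m, b) * g b) * Mo m π o =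
      p π * ∑ b, margPi ν b * g b := by
    intro π
    rw [Finset.sum_comm, Finset.mul_sum]
    refine Finset.sum_congr rfl fun b _ => ?_
    rw [Finset.sum_comm]
    simp_rw [← Finset.mul_sum, (hMo _ π).2, mul_one, ← Finset.mul_sum, ← Finset.sum_mul]
    rfl
  rw [Finset.sum_comm]
  have hπ : ∀ π, ∑ x : M × P, ∑ o, ν x * p π * Mo x.1 π o * ∑ b, post Mo ν π o b * g b =
      p π * ∑ b, margPi ν b * g b := by
    intro π
    rw [Finset.sum_comm, ← hobs π]
    exact Finset.sum_congr rfl fun o _ => hpo π o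
  simp_rw [hπ]
  rw [← Finset.sum_mul, hp.2, one_mul]

end

/-- Bounding AIR by the information ratio:
`AIR_{q,η}(p,ν) ≤ (η/4)·IR(ν,p)` whenever the information gain is positive. -/
theorem air_le_information_ratio
    {M P O : Type*} [Fintype M] [Nonempty M] [Fintype P] [Nonempty P]
    [Fintype O] [Nonempty O]
    (Mo : M → P → O → ℝ) (hMo : ∀ m π, IsProb (Mo m π))
    (f : M → P → ℝ) (η : ℝ) (hη : 0 < η)
    (q : P → ℝ) (hq : IsProb q) (hqpos : ∀ π, 0 < q π)
    (p : P → ℝ) (hp : IsProb p)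
    (ν : M × P → ℝ) (hν : IsProb ν)
    (hI : 0 < ∑ x : M × P, ∑ π, ∑ o,
        ν x * p π * Mo x.1 π o * KLr (post Mo ν π o) (margPi ν)) :
    AIR Mo f q p η ν ≤ (η / 4) *
      ((∑ x : M × P, ∑ π, ν x * p π * (f x.1 x.2 - f x.1 π)) ^ 2 /
        ∑ x : M × P, ∑ π, ∑ o,
          ν x * p π * Mo x.1 π o * KLr (post Mo ν π o) (margPi ν)) := by
  set A := ∑ x : M × P, ∑ π, ν x * p π * (f x.1 x.2 - f x.1 π)
  set I := ∑ x : M × P, ∑ π, ∑ o, ν x * p π * Mo x.1 π o * KLr (post Mo ν π o) (margPi ν)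
    with hIdef
  have hA : A = ∑ x : M × P, ∑ π, ∑ o, ν x * p π * Mo x.1 π o * (f x.1 x.2 - f x.1 π) := by
    refine Finset.sum_congr rfl fun x _ => Finset.sum_congr rfl fun π _ => ?_
    rw [← Finset.sum_mul, ← Finset.mul_sum, (hMo x.1 π).2, mul_one]
  have hAIR : AIR Mo f q p η ν = A - (1 / η) * (I + KLr (margPi ν) q) := by
    rw [KLr, ← sum_post_mul_eq hMo hp hν, hA, hIdef]
    simp only [AIR, KLr_post_eq hν hqpos, Finset.mul_sum (a := 1 / η),
      ← Finset.sum_add_distrib, ← Finset.sum_sub_distrib]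
    exact Finset.sum_congr rfl fun x _ => Finset.sum_congr rfl fun π _ =>
      Finset.sum_congr rfl fun o _ => by ring
  have hKL := mul_nonneg (one_div_pos.2 hη).le (KLr_nonneg (isProb_margPi hν) hq hqpos)
  have hsq : η / 4 * (A ^ 2 / I) - (A - 1 / η * I) = (η * A - 2 * I) ^ 2 / (4 * η * I) := by
    field_simp
    ring
  have hnn : 0 ≤ (η * A - 2 * I) ^ 2 / (4 * η * I) := by positivity
  rw [hAIR]
  linarith
end

section
/- Relationship of MAIR and AIR: fix a selection π_· assigning to each M ∈ 𝓜 a decision π_M ∈ Π with f_M(π_M) = max_{π'∈Π} f_M(π'). Let μ ∈ Δ(𝓜), let ρ ∈ Δ(𝓜) have all coordinates positive, let q ∈ Δ(Π) be the pushforward q(π̄) := Σ_{M : π_M = π̄} ρ(M), and let ν ∈ Δ(𝓜×Π) be the induced joint distribution ν(M,π̄) := μ(M)·1[π̄ = π_M]. Then for every η > 0 and every p ∈ Δ(Π), MAIR_{ρ,η}(p,μ) ≤ AIR_{q,η}(p,ν). -/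
open Finset

/-- Model-index Algorithmic Information Ratio with a fixed argmax selection `πsel`:
`MAIR_{ρ,η}(p,μ) = Σ_{M,π,o} μ(M)·p(π)·[M(π)](o)·( f_M(π_M) − f_M(π) − (1/η)·KL(μ(·|π,o), ρ) )`,
where `μ(·|π,o)` is the Bayesian model posterior. -/
noncomputable def MAIRsel {M P O : Type*} [Fintype M] [Fintype P] [Fintype O]
    (Mo : M → P → O → ℝ) (f : M → P → ℝ) (πsel : M → P)
    (ρ : M → ℝ) (p : P → ℝ) (η : ℝ) (μ : M → ℝ) : ℝ :=
  ∑ m, ∑ π, ∑ o, μ m * p π * Mo m π o *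
    (f m (πsel m) - f m π -
      (1 / η) * KLr (fun m' => μ m' * Mo m' π o / ∑ m'', μ m'' * Mo m'' π o) ρ)

/-- The log-sum inequality. -/
theorem sum_mul_log_sum_div_le {ι : Type*} (s : Finset ι) (a b : ι → ℝ)
    (ha : ∀ i ∈ s, 0 ≤ a i) (hb : ∀ i ∈ s, 0 < b i) :
    (∑ i ∈ s, a i) * Real.log ((∑ i ∈ s, a i) / ∑ i ∈ s, b i)
      ≤ ∑ i ∈ s, a i * Real.log (a i / b i) := by
  rcases (sum_nonneg ha).eq_or_lt with hA | hA
  · have h0 : ∀ i ∈ s, a i = 0 := (sum_eq_zero_iff_of_nonneg ha).1 hA.symm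
    rw [← hA, zero_mul]
    exact (sum_eq_zero fun i hi => by rw [h0 i hi, zero_mul]).ge
  have hs : s.Nonempty := by
    rw [nonempty_iff_ne_empty]
    rintro rfl
    simp at hA
  have hB : 0 < ∑ i ∈ s, b i := sum_pos hb hs
  set A := ∑ i ∈ s, a i with hA_def
  set B := ∑ i ∈ s, b i with hB_def
  have key : ∀ i ∈ s, a i * Real.log (A / B) + (a i - b i * (A / B))
      ≤ a i * Real.log (a i / b i) := by
    intro i hi
    have hbi := hb i hi
    have hAB : 0 < A / B := div_pos hA hB
    rcases (ha i hi).eq_or_lt with h | h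
    · rw [← h]
      have := mul_pos hbi hAB
      linarith
    · have hl := Real.log_le_sub_one_of_pos (div_pos hAB (div_pos h hbi))
      rw [Real.log_div hAB.ne' (div_pos h hbi).ne'] at hl
      have hm := mul_le_mul_of_nonneg_left hl h.le
      have he : a i * (A / B / (a i / b i) - 1) = b i * (A / B) - a i := by
        field_simp
      rw [he] at hm
      linarith
  have hsum := sum_le_sum key
  rw [sum_add_distrib, sum_sub_distrib, ← sum_mul, ← sum_mul, ← hA_def, ← hB_def,
    mul_div_cancel₀ A hB.ne', sub_self, add_zero] at hsum
  exact hsum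

/-- Data processing: the KL divergence does not increase under a pushforward. -/
theorem KLr_pushforward_le {S T : Type*} [Fintype S] [Fintype T] [DecidableEq T]
    (g : S → T) (a b : S → ℝ) (ha : ∀ s, 0 ≤ a s) (hb : ∀ s, 0 < b s) :
    KLr (fun t => ∑ s, if g s = t then a s else 0) (fun t => ∑ s, if g s = t then b s else 0)
      ≤ KLr a b := by
  unfold KLr
  rw [← sum_fiberwise univ g fun s => a s * Real.log (a s / b s)]
  refine sum_le_sum fun t _ => ?_
  simp only [← sum_filter]
  exact sum_mul_log_sum_div_le _ a b (fun i _ => ha i) fun i _ => hb i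

/-- Summing against the joint law of `(m, g m)` evaluates at `g m`. -/
theorem sum_prod_graph {M P : Type*} [Fintype M] [Fintype P] [DecidableEq P]
    (g : M → P) (F : M × P → ℝ) :
    ∑ x : M × P, (if x.2 = g x.1 then F x else 0) = ∑ m, F (m, g m) := by
  simp [Fintype.sum_prod_type]

/-- The posterior of the optimal decision is the pushforward of the model posterior. -/
theorem post_graph {M P O : Type*} [Fintype M] [Fintype P] [Fintype O] [DecidableEq P]
    (Mo : M → P → O → ℝ) (g : M → P) (μ : M → ℝ) (π : P) (o : O) :
    post Mo (fun x => μ x.1 * (if x.2 = g x.1 then 1 else 0)) π o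
      = fun t => ∑ m, if g m = t then μ m * Mo m π o / ∑ m', μ m' * Mo m' π o else 0 := by
  have hobs : mObs Mo (fun x => μ x.1 * (if x.2 = g x.1 then 1 else 0)) π o
      = ∑ m, μ m * Mo m π o := by
    rw [mObs, ← sum_prod_graph g fun x => μ x.1 * Mo x.1 π o]
    exact sum_congr rfl fun x _ => by split_ifs <;> ring
  funext t
  rw [post, hobs, sum_div]
  refine sum_congr rfl fun m _ => ?_
  simp only [eq_comm (a := t)]
  split_ifs <;> simp

/-- Relationship of MAIR and AIR: if `q` is the pushforward of `ρ` under the argmax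
selection `π_·`, and `ν` is the joint law of `(M, π_M)` induced by `μ`, then
`MAIR_{ρ,η}(p,μ) ≤ AIR_{q,η}(p,ν)`. -/
theorem mair_le_air
    {M P O : Type*} [Fintype M] [Nonempty M] [Fintype P] [Nonempty P] [DecidableEq P]
    [Fintype O] [Nonempty O]
    (Mo : M → P → O → ℝ) (hMo : ∀ m π, IsProb (Mo m π))
    (f : M → P → ℝ)
    (πsel : M → P) (hsel : ∀ m π', f m π' ≤ f m (πsel m))
    (μ : M → ℝ) (hμ : IsProb μ)
    (ρ : M → ℝ) (hρ : IsProb ρ) (hρpos : ∀ m, 0 < ρ m)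
    (η : ℝ) (hη : 0 < η)
    (p : P → ℝ) (hp : IsProb p) :
    MAIRsel Mo f πsel ρ p η μ
      ≤ AIR Mo f (fun π' => ∑ m, if πsel m = π' then ρ m else 0) p η
          (fun x => μ x.1 * (if x.2 = πsel x.1 then 1 else 0)) := by
  have hair : AIR Mo f (fun π' => ∑ m, if πsel m = π' then ρ m else 0) p η
        (fun x => μ x.1 * (if x.2 = πsel x.1 then 1 else 0))
      = ∑ m, ∑ π, ∑ o, μ m * p π * Mo m π o * (f m (πsel m) - f m π - (1 / η) *
          KLr (fun t => ∑ m, if πsel m = t then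
              μ m * Mo m π o / ∑ m', μ m' * Mo m' π o else 0)
            (fun π' => ∑ m, if πsel m = π' then ρ m else 0)) := by
    rw [AIR, ← sum_prod_graph πsel fun x => ∑ π, ∑ o, μ x.1 * p π * Mo x.1 π o *
      (f x.1 x.2 - f x.1 π - (1 / η) * KLr (fun t => ∑ m, if πsel m = t then
              μ m * Mo m π o / ∑ m', μ m' * Mo m' π o else 0)
            (fun π' => ∑ m, if πsel m = π' then ρ m else 0))]
    refine sum_congr rfl fun x _ => ?_
    simp only [post_graph]
    split_ifs <;> simp
  rw [hair, MAIRsel]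
  refine sum_le_sum fun m _ => sum_le_sum fun π _ => sum_le_sum fun o _ => ?_
  have hw : ∀ m', 0 ≤ μ m' * Mo m' π o := fun m' => mul_nonneg (hμ.1 m') ((hMo m' π).1 o)
  have hkl := KLr_pushforward_le πsel (fun m' => μ m' * Mo m' π o / ∑ m'', μ m'' * Mo m'' π o) ρ
    (fun m' => div_nonneg (hw m') (sum_nonneg fun i _ => hw i)) hρpos
  exact mul_le_mul_of_nonneg_left
    (sub_le_sub_left (mul_le_mul_of_nonneg_left hkl (one_div_pos.2 hη).le) _)
    (mul_nonneg (mul_nonneg (hμ.1 m) (hp.1 π)) ((hMo m π).1 o))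
end

section
/- Bounding MAIR by DEC: for every η > 0, the supremum over ρ ∈ Δ(𝓜) with all coordinates positive and over μ ∈ Δ(𝓜) of the infimum over p ∈ Δ(Π) of MAIR_{ρ,η}(p,μ) equals DEC^KL_η(𝓜), and this common value is at most DEC_η(𝓜). -/
open Finset

/-- Squared Hellinger distance between probability vectors on a finite set. -/
noncomputable def Hsq {S : Type*} [Fintype S] (p q : S → ℝ) : ℝ :=
  ∑ x, (Real.sqrt (p x) - Real.sqrt (q x)) ^ 2

open scoped Classical in
/-- Extended-real-valued KL divergence on a finite set, with the convention
`KL(p,q) = +∞` if `p(x) > 0 = q(x)` for some `x`, and `0·log(0/y) = 0` otherwise. -/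
noncomputable def KLe {S : Type*} [Fintype S] (p q : S → ℝ) : EReal :=
  if ∀ x, 0 < p x → 0 < q x then ((∑ x, p x * Real.log (p x / q x) : ℝ) : EReal) else ⊤

/-- A model is a pair: an observation kernel `Π → Δ(O)` together with a mean reward
function `Π → ℝ`; model classes are sets of such pairs, and `conv` is the convex hull
in this product space (for a finite class, exactly the mixture models). -/
abbrev ModelPair (P O : Type*) := (P → O → ℝ) × (P → ℝ)

/-- KL version of the decision-estimation coefficient of a class `C` of models:
`DEC^KL_η(C) = sup_{M̄ ∈ conv(C)} inf_{p ∈ Δ(Π)} sup_{M ∈ C}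
  Σ_π p(π)·( f_M(π_M) − f_M(π) − (1/η)·KL(M(π), M̄(π)) )`,
with `f_M(π_M) = max_{π'} f_M(π')`, valued in the extended reals. -/
noncomputable def decKLgen {P O : Type*} [Fintype P] [Nonempty P] [Fintype O]
    (C : Set (ModelPair P O)) (η : ℝ) : EReal :=
  ⨆ Mb ∈ convexHull ℝ C, ⨅ p ∈ {p : P → ℝ | IsProb p}, ⨆ Mi ∈ C,
    ∑ π, (p π : EReal) *
      ((((⨆ π', Mi.2 π') - Mi.2 π : ℝ) : EReal)
        - ((1 / η : ℝ) : EReal) * KLe (Mi.1 π) (Mb.1 π))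

/-- Squared-Hellinger version of the decision-estimation coefficient `DEC_η(C)`. -/
noncomputable def decHgen {P O : Type*} [Fintype P] [Nonempty P] [Fintype O]
    (C : Set (ModelPair P O)) (η : ℝ) : EReal :=
  ⨆ Mb ∈ convexHull ℝ C, ⨅ p ∈ {p : P → ℝ | IsProb p}, ⨆ Mi ∈ C,
    ((∑ π, p π * ((⨆ π', Mi.2 π') - Mi.2 π - (1 / η) * Hsq (Mi.1 π) (Mb.1 π)) : ℝ) : EReal)

/-- Model-index Algorithmic Information Ratio:
`MAIR_{ρ,η}(p,μ) = Σ_{M,π,o} μ(M)·p(π)·[M(π)](o)·( f_M(π_M) − f_M(π) − (1/η)·KL(μ(·|π,o), ρ) )`,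
where `f_M(π_M) = max_{π'} f_M(π')` and `μ(·|π,o)` is the Bayesian model posterior. -/
noncomputable def MAIR {Mι P O : Type*} [Fintype Mι] [Fintype P] [Nonempty P] [Fintype O]
    (Mo : Mι → P → O → ℝ) (f : Mι → P → ℝ)
    (ρ : Mι → ℝ) (p : P → ℝ) (η : ℝ) (μ : Mι → ℝ) : ℝ :=
  ∑ m, ∑ π, ∑ o, μ m * p π * Mo m π o *
    ((⨆ π', f m π') - f m π -
      (1 / η) * KLr (fun m' => μ m' * Mo m' π o / ∑ m'', μ m'' * Mo m'' π o) ρ)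

section Divergence

lemma sub_le_mul_log_div {a b : ℝ} (ha : 0 ≤ a) (hb : 0 ≤ b) (hab : 0 < a → 0 < b) :
    a - b ≤ a * Real.log (a / b) := by
  rcases ha.eq_or_lt with rfl | ha
  · simpa using hb
  · have hb := hab ha
    have h := Real.one_sub_inv_le_log_of_pos (div_pos ha hb)
    calc a - b = a * (1 - (a / b)⁻¹) := by field_simp
      _ ≤ _ := by gcongr

lemma sq_sqrt_sub_sqrt_add_le_mul_log_div {a b : ℝ} (ha : 0 ≤ a) (hb : 0 ≤ b)
    (hab : 0 < a → 0 < b) :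
    (Real.sqrt a - Real.sqrt b) ^ 2 + (a - b) ≤ a * Real.log (a / b) := by
  have h := sub_le_mul_log_div (Real.sqrt_nonneg a) (Real.sqrt_nonneg b)
    (fun h => Real.sqrt_pos.2 (hab (Real.sqrt_pos.1 h)))
  have hlog : Real.log (Real.sqrt a / Real.sqrt b) = Real.log (a / b) / 2 := by
    rw [← Real.sqrt_div ha, Real.log_sqrt (by positivity)]
  rw [hlog] at h
  have h' := mul_le_mul_of_nonneg_left h (Real.sqrt_nonneg a)
  have ha' := Real.mul_self_sqrt ha
  have hb' := Real.mul_self_sqrt hb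
  linear_combination 2 * h' + (Real.log (a / b) - 1) * ha' + hb'

variable {S : Type*} [Fintype S] {p q : S → ℝ}

lemma IsProb.klr_nonneg (hp : IsProb p) (hq : IsProb q) (h : ∀ x, 0 < p x → 0 < q x) :
    0 ≤ KLr p q := by
  have := Finset.sum_le_sum fun x (_ : x ∈ univ) =>
    sub_le_mul_log_div (hp.1 x) (hq.1 x) (h x)
  rw [Finset.sum_sub_distrib, hp.2, hq.2, sub_self] at this
  exact this

lemma IsProb.hsq_le_klr (hp : IsProb p) (hq : IsProb q) (h : ∀ x, 0 < p x → 0 < q x) :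
    Hsq p q ≤ KLr p q := by
  have := Finset.sum_le_sum fun x (_ : x ∈ univ) =>
    sq_sqrt_sub_sqrt_add_le_mul_log_div (hp.1 x) (hq.1 x) (h x)
  rw [Finset.sum_add_distrib, Finset.sum_sub_distrib, hp.2, hq.2, sub_self, add_zero] at this
  exact this

lemma kle_eq_coe_klr (h : ∀ x, 0 < p x → 0 < q x) : KLe p q = (KLr p q : EReal) :=
  if_pos h

lemma kle_eq_top (h : ¬ ∀ x, 0 < p x → 0 < q x) : KLe p q = ⊤ :=
  if_neg h

/-- Mixing a probability vector with the uniform one makes it positive, at a controlled cost. -/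
lemma IsProb.exists_pos_klr_le [Nonempty S] (hp : IsProb p) {δ : ℝ} (hδ : 0 < δ) :
    ∃ q : S → ℝ, IsProb q ∧ (∀ x, 0 < q x) ∧ KLr p q ≤ δ := by
  have ht0 := Real.exp_pos (-δ)
  have ht1 : Real.exp (-δ) < 1 := by simpa using hδ
  set t := Real.exp (-δ) with ht
  have hcard : 0 < (Fintype.card S : ℝ) := by exact_mod_cast Fintype.card_pos
  have hu : 0 < (1 - t) / Fintype.card S := div_pos (by linarith) hcard
  have hpos : ∀ x, 0 < t * p x + (1 - t) / Fintype.card S := fun x =>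
    add_pos_of_nonneg_of_pos (mul_nonneg ht0.le (hp.1 x)) hu
  refine ⟨fun x => t * p x + (1 - t) / Fintype.card S, ⟨fun x => (hpos x).le, ?_⟩, hpos, ?_⟩
  · rw [Finset.sum_add_distrib, ← Finset.mul_sum, hp.2]
    simp only [sum_const, card_univ, nsmul_eq_mul]
    field_simp
    ring
  · calc KLr p _ ≤ ∑ x, p x * δ := by
          refine Finset.sum_le_sum fun x _ => ?_
          rcases (hp.1 x).eq_or_lt with h | h
          · simp [← h]
          · refine mul_le_mul_of_nonneg_left ?_ h.le
            rw [Real.log_le_iff_le_exp (div_pos h (hpos x)), div_le_iff₀ (hpos x)]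
            have he : Real.exp δ * t = 1 := by rw [ht, ← Real.exp_add]; simp
            have := mul_pos (Real.exp_pos δ) hu
            linear_combination this.le - p x * he
      _ = δ := by rw [← Finset.sum_mul, hp.2, one_mul]

end Divergence

section Game

variable {P ι : Type*} [Fintype P] [Fintype ι]

/-- Von Neumann's minimax theorem for a matrix game in which the maximizing player is restricted
to the actions satisfying `F`. -/
lemma exists_matrix_game_value [Nonempty P] (A : ι → P → ℝ) {F : ι → Prop} (hF : ∃ i, F i) :
    ∃ (v : ℝ) (p : P → ℝ) (μ : ι → ℝ), IsProb p ∧ IsProb μ ∧ (∀ i, 0 < μ i → F i) ∧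
      (∀ i, F i → ∑ π, p π * A i π ≤ v) ∧
      ∀ p', IsProb p' → v ≤ ∑ i, μ i * ∑ π, p' π * A i π := by
  classical
  let Y : Set (ι → ℝ) := stdSimplex ℝ ι ∩ {μ | ∀ i, ¬ F i → μ i = 0}
  have hZ : Convex ℝ {μ : ι → ℝ | ∀ i, ¬ F i → μ i = 0} := by
    intro x hx y hy a b _ _ _ i hi
    simp [hx i hi, hy i hi]
  have hZc : IsClosed {μ : ι → ℝ | ∀ i, ¬ F i → μ i = 0} := by
    simp only [Set.ofPred_forall]
    exact isClosed_iInter fun i => isClosed_iInter fun _ =>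
      isClosed_eq (continuous_apply i) continuous_const
  have hsingle : ∀ i, F i → Pi.single i 1 ∈ Y := fun i hi =>
    ⟨single_mem_stdSimplex ℝ i, fun j hj => Pi.single_eq_of_ne (fun h => hj (by rwa [h])) 1⟩
  let Φ : (P → ℝ) → (ι → ℝ) → ℝ := fun p μ => ∑ i, μ i * ∑ π, p π * A i π
  have hsaddle : ∃ a ∈ stdSimplex ℝ P, ∃ b ∈ Y, IsSaddlePointOn (stdSimplex ℝ P) Y Φ a b := by
    obtain ⟨i, hi⟩ := hF
    refine Sion.exists_isSaddlePointOn
      ⟨_, single_mem_stdSimplex ℝ (Classical.arbitrary P)⟩ (convex_stdSimplex ℝ P)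
      (isCompact_stdSimplex ℝ P) ?_ ?_ ((convex_stdSimplex ℝ ι).inter hZ) ⟨_, hsingle i hi⟩
      ((isCompact_stdSimplex ℝ ι).inter_right hZc) ?_ ?_
    · intro μ _
      exact Continuous.continuousOn (by fun_prop) |>.lowerSemicontinuousOn
    · intro μ _
      refine ConvexOn.quasiconvexOn ⟨convex_stdSimplex ℝ P, fun x _ y _ a b _ _ _ => le_of_eq ?_⟩
      simp only [Φ, Pi.add_apply, Pi.smul_apply, smul_eq_mul, Finset.mul_sum,
        ← Finset.sum_add_distrib]
      exact Finset.sum_congr rfl fun i _ => Finset.sum_congr rfl fun π _ => by ring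
    · intro p _
      exact Continuous.continuousOn (by fun_prop) |>.upperSemicontinuousOn
    · intro p _
      refine ConcaveOn.quasiconcaveOn
        ⟨(convex_stdSimplex ℝ ι).inter hZ, fun x _ y _ a b _ _ _ => le_of_eq ?_⟩
      simp only [Φ, Pi.add_apply, Pi.smul_apply, smul_eq_mul, Finset.mul_sum,
        ← Finset.sum_add_distrib]
      exact Finset.sum_congr rfl fun i _ => Finset.sum_congr rfl fun π _ => by ring
  obtain ⟨p, hp, μ, hμ, h⟩ := hsaddle
  refine ⟨Φ p μ, p, μ, hp, hμ.1, fun i hi => ?_, fun i hi => ?_, fun p' hp' => h p' hp' μ hμ⟩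
  · by_contra hFi
    exact hi.ne' (hμ.2 i hFi)
  · simpa [Φ, Pi.single_apply] using h p hp _ (hsingle i hi)

/-- An approximately optimal strategy of the minimizing player with full support. -/
lemma exists_pos_isProb_le [Nonempty P] (A : ι → P → ℝ) {F : ι → Prop} {p : P → ℝ} {v z : ℝ}
    (hp : IsProb p) (h : ∀ i, F i → ∑ π, p π * A i π ≤ v) (hvz : v < z) :
    ∃ q : P → ℝ, IsProb q ∧ (∀ π, 0 < q π) ∧ ∀ i, F i → ∑ π, q π * A i π ≤ z := by
  have hcard : 0 < (Fintype.card P : ℝ) := by exact_mod_cast Fintype.card_pos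
  let u : ℝ := 1 / Fintype.card P
  have hu : 0 < u := by positivity
  let B : ℝ := ∑ i, |∑ π, u * A i π|
  have hB : ∀ i, ∑ π, u * A i π ≤ B := fun i => (le_abs_self _).trans
    (Finset.single_le_sum (f := fun i => |∑ π, u * A i π|) (fun i _ => abs_nonneg _) (mem_univ i))
  have hD : 0 < (z - v) + |B - v| := add_pos_of_pos_of_nonneg (by linarith) (abs_nonneg _)
  let s : ℝ := (z - v) / ((z - v) + |B - v|)
  have hs0 : 0 < s := div_pos (by linarith) hD
  have hs1 : s ≤ 1 := by
    rw [div_le_one hD]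
    linarith [abs_nonneg (B - v)]
  have hsB : s * (B - v) ≤ z - v := by
    rw [div_mul_eq_mul_div, div_le_iff₀ hD]
    exact mul_le_mul_of_nonneg_left (by linarith [le_abs_self (B - v)]) (by linarith)
  have hpos : ∀ π, 0 < (1 - s) * p π + s * u := fun π =>
    add_pos_of_nonneg_of_pos (mul_nonneg (by linarith) (hp.1 π)) (mul_pos hs0 hu)
  refine ⟨fun π => (1 - s) * p π + s * u, ⟨fun π => (hpos π).le, ?_⟩, hpos, fun i hi => ?_⟩
  · rw [Finset.sum_add_distrib, ← Finset.mul_sum, hp.2]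
    simp only [sum_const, card_univ, nsmul_eq_mul, u]
    field_simp
    ring
  · have heq : ∑ π, ((1 - s) * p π + s * u) * A i π
        = (1 - s) * ∑ π, p π * A i π + s * ∑ π, u * A i π := by
      rw [Finset.mul_sum, Finset.mul_sum, ← Finset.sum_add_distrib]
      exact Finset.sum_congr rfl fun π _ => by ring
    rw [heq]
    have h1 := mul_le_mul_of_nonneg_left (h i hi) (sub_nonneg.2 hs1)
    have h2 := mul_le_mul_of_nonneg_left (hB i) hs0.le
    linarith

end Game

section ExtendedReals

variable {α : Type*}

lemma EReal.coe_finset_sum_eq (s : Finset α) (g : α → ℝ) :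
    ((∑ x ∈ s, g x : ℝ) : EReal) = ∑ x ∈ s, (g x : EReal) := by
  classical
  induction s using Finset.induction_on with
  | empty => simp
  | insert a s ha ih => rw [Finset.sum_insert ha, Finset.sum_insert ha, EReal.coe_add, ih]

lemma EReal.sum_eq_bot_of_mem {s : Finset α} {g : α → EReal} {a : α} (ha : a ∈ s)
    (h : g a = ⊥) : ∑ x ∈ s, g x = ⊥ := by
  classical
  rw [← Finset.add_sum_erase s g ha, h, EReal.bot_add]

end ExtendedReals

section Mixture

variable {P O ι : Type*} [Fintype ι]

/-- The observation kernel of the mixture model with weights `μ`. -/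
noncomputable def mixObs (Mo : ι → P → O → ℝ) (μ : ι → ℝ) (π : P) (o : O) : ℝ :=
  ∑ i, μ i * Mo i π o

variable {Mo : ι → P → O → ℝ} {μ : ι → ℝ}

lemma exists_mixObs_of_mem_convexHull {f : ι → P → ℝ} {Mb : ModelPair P O}
    (h : Mb ∈ convexHull ℝ (Set.range fun i => ((Mo i, f i) : ModelPair P O))) :
    ∃ μ : ι → ℝ, IsProb μ ∧ Mb.1 = mixObs Mo μ := by
  classical
  let L := Fintype.linearCombination ℝ (fun i => ((Mo i, f i) : ModelPair P O))
  have hsub : convexHull ℝ (Set.range fun i => ((Mo i, f i) : ModelPair P O))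
      ⊆ L '' stdSimplex ℝ ι := by
    refine convexHull_min ?_ ((convex_stdSimplex ℝ ι).linear_image L)
    rintro _ ⟨i, rfl⟩
    exact ⟨_, single_mem_stdSimplex ℝ i, by simp [L]⟩
  obtain ⟨μ, hμ, rfl⟩ := hsub h
  refine ⟨μ, hμ, ?_⟩
  ext π o
  simp [L, Fintype.linearCombination_apply, Prod.fst_sum, mixObs]

lemma mixture_mem_convexHull {f : ι → P → ℝ} (hμ : IsProb μ) :
    (∑ i, μ i • ((Mo i, f i) : ModelPair P O)) ∈
      convexHull ℝ (Set.range fun i => ((Mo i, f i) : ModelPair P O)) :=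
  (convex_convexHull ℝ _).sum_mem (fun i _ => hμ.1 i) hμ.2
    fun i _ => subset_convexHull ℝ _ ⟨i, rfl⟩

lemma fst_mixture {f : ι → P → ℝ} :
    (∑ i, μ i • ((Mo i, f i) : ModelPair P O)).1 = mixObs Mo μ := by
  ext π o
  simp [Prod.fst_sum, mixObs]

variable [Fintype O]

lemma isProb_mixObs (hMo : ∀ i π, IsProb (Mo i π)) (hμ : IsProb μ) (π : P) :
    IsProb (mixObs Mo μ π) := by
  refine ⟨fun o => Finset.sum_nonneg fun i _ => mul_nonneg (hμ.1 i) ((hMo i π).1 o), ?_⟩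
  simp only [mixObs]
  rw [Finset.sum_comm]
  simp [← Finset.mul_sum, (hMo _ π).2, hμ.2]

lemma mixObs_pos (hMo : ∀ i π, IsProb (Mo i π)) (hμ : IsProb μ) {i : ι} (hi : 0 < μ i)
    {π : P} {o : O} (ho : 0 < Mo i π o) : 0 < mixObs Mo μ π o :=
  (mul_pos hi ho).trans_le <| Finset.single_le_sum (f := fun i => μ i * Mo i π o)
    (fun j _ => mul_nonneg (hμ.1 j) ((hMo j π).1 o)) (mem_univ i)

/-- The expected divergence from the posterior to the prior splits into the mutual information and
the divergence of the belief from the prior. -/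
lemma sum_mul_klr_posterior (hMo : ∀ i π, IsProb (Mo i π)) (hμ : IsProb μ) {ρ : ι → ℝ}
    (hρ : ∀ i, 0 < ρ i) (π : P) :
    ∑ i, ∑ o, μ i * Mo i π o * KLr (fun j => μ j * Mo j π o / mixObs Mo μ π o) ρ
      = ∑ i, μ i * KLr (Mo i π) (mixObs Mo μ π) + KLr μ ρ := by
  have hL : ∑ i, ∑ o, μ i * Mo i π o * KLr (fun j => μ j * Mo j π o / mixObs Mo μ π o) ρ
      = ∑ j, ∑ o, (μ j * Mo j π o * Real.log (Mo j π o / mixObs Mo μ π o)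
          + Mo j π o * (μ j * Real.log (μ j / ρ j))) := by
    refine Finset.sum_comm.trans (Eq.trans ?_ Finset.sum_comm)
    refine Finset.sum_congr rfl fun o _ => ?_
    rw [← Finset.sum_mul]
    change mixObs Mo μ π o * _ = _
    simp only [KLr]
    rw [Finset.mul_sum]
    refine Finset.sum_congr rfl fun j _ => ?_
    rcases (hμ.1 j).eq_or_lt with hj | hj
    · simp [← hj]
    rcases ((hMo j π).1 o).eq_or_lt with ho | ho
    · simp [← ho]
    have hm := mixObs_pos hMo hμ hj ho
    have hlog : Real.log (μ j * Mo j π o / mixObs Mo μ π o / ρ j)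
        = Real.log (Mo j π o / mixObs Mo μ π o) + Real.log (μ j / ρ j) := by
      rw [← Real.log_mul (div_pos ho hm).ne' (div_pos hj (hρ j)).ne']
      congr 1
      ring
    rw [hlog]
    field_simp
  rw [hL]
  simp only [KLr, Finset.sum_add_distrib]
  congr 1
  · simp only [Finset.mul_sum, mul_assoc]
  · exact Finset.sum_congr rfl fun j _ => by rw [← Finset.sum_mul, (hMo j π).2, one_mul]

/-- The mixture minimizes the average divergence over reference distributions. -/
lemma sum_mul_klr_mixObs_le (hMo : ∀ i π, IsProb (Mo i π)) (hμ : IsProb μ) {π : P}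
    {q : O → ℝ} (hq : IsProb q) (hac : ∀ i, 0 < μ i → ∀ o, 0 < Mo i π o → 0 < q o) :
    ∑ i, μ i * KLr (Mo i π) (mixObs Mo μ π) ≤ ∑ i, μ i * KLr (Mo i π) q := by
  have hm := isProb_mixObs hMo hμ π
  have hmq : ∀ o, 0 < mixObs Mo μ π o → 0 < q o := by
    intro o ho
    obtain ⟨i, -, hi⟩ := Finset.exists_lt_of_sum_lt (s := univ) (f := fun _ : ι => (0 : ℝ))
      (g := fun i => μ i * Mo i π o) (by simpa [mixObs] using ho)
    have hμi : 0 < μ i := (hμ.1 i).lt_of_ne fun h => by simp [← h] at hi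
    exact hac i hμi o (pos_of_mul_pos_right hi (hμ.1 i))
  have hdiff : ∑ i, μ i * KLr (Mo i π) q - ∑ i, μ i * KLr (Mo i π) (mixObs Mo μ π)
      = KLr (mixObs Mo μ π) q := by
    simp only [KLr, Finset.mul_sum]
    rw [Finset.sum_comm, Finset.sum_comm (γ := ι), ← Finset.sum_sub_distrib]
    refine Finset.sum_congr rfl fun o _ => ?_
    conv_rhs => rw [mixObs, Finset.sum_mul]
    rw [← Finset.sum_sub_distrib]
    refine Finset.sum_congr rfl fun i _ => ?_
    rcases (hμ.1 i).eq_or_lt with hi | hi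
    · simp [← hi]
    rcases ((hMo i π).1 o).eq_or_lt with ho | ho
    · simp [← ho]
    have h1 := mixObs_pos hMo hμ hi ho
    have h2 := hac i hi o ho
    change _ = μ i * Mo i π o * Real.log (mixObs Mo μ π o / q o)
    rw [Real.log_div ho.ne' h2.ne', Real.log_div ho.ne' h1.ne', Real.log_div h1.ne' h2.ne']
    ring
  linarith [hm.klr_nonneg hq hmq]

variable [Fintype P]

/-- The regret of decision `π` under the mean reward function `f`. -/
noncomputable def regret (f : P → ℝ) (π : P) : ℝ :=
  (⨆ π', f π') - f π

/-- The decision-estimation objective against the reference kernel `q`, averaged over `μ`. -/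
noncomputable def avgDecKL (Mo : ι → P → O → ℝ) (f : ι → P → ℝ) (η : ℝ) (μ : ι → ℝ)
    (q : P → O → ℝ) (p : P → ℝ) : ℝ :=
  ∑ i, μ i * ∑ π, p π * (regret (f i) π - 1 / η * KLr (Mo i π) (q π))

lemma avgDecKL_eq_sum (f : ι → P → ℝ) (η : ℝ) (q : P → O → ℝ) (p : P → ℝ) :
    avgDecKL Mo f η μ q p = ∑ π, p π *
      (∑ i, μ i * regret (f i) π - 1 / η * ∑ i, μ i * KLr (Mo i π) (q π)) := by
  simp only [avgDecKL, Finset.mul_sum, ← Finset.sum_sub_distrib]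
  rw [Finset.sum_comm]
  exact Finset.sum_congr rfl fun π _ => Finset.sum_congr rfl fun i _ => by ring

lemma mair_eq [Nonempty P] (hMo : ∀ i π, IsProb (Mo i π)) (hμ : IsProb μ) {ρ : ι → ℝ}
    (hρ : ∀ i, 0 < ρ i) (f : ι → P → ℝ) (η : ℝ) {p : P → ℝ} (hp : IsProb p) :
    MAIR Mo f ρ p η μ = avgDecKL Mo f η μ (mixObs Mo μ) p - 1 / η * KLr μ ρ := by
  have h1 : MAIR Mo f ρ p η μ = ∑ π, p π * (∑ i, μ i * regret (f i) π
      - 1 / η * (∑ i, μ i * KLr (Mo i π) (mixObs Mo μ π) + KLr μ ρ)) := by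
    unfold MAIR
    rw [Finset.sum_comm]
    refine Finset.sum_congr rfl fun π _ => ?_
    rw [← sum_mul_klr_posterior hMo hμ hρ π, Finset.mul_sum, ← Finset.sum_sub_distrib,
      Finset.mul_sum]
    refine Finset.sum_congr rfl fun i _ => ?_
    have h2 : μ i * regret (f i) π = ∑ o, μ i * regret (f i) π * Mo i π o := by
      rw [← Finset.mul_sum, (hMo i π).2, mul_one]
    rw [h2, Finset.mul_sum, ← Finset.sum_sub_distrib, Finset.mul_sum]
    refine Finset.sum_congr rfl fun o _ => ?_
    simp only [regret, mixObs]
    ring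
  have h3 : 1 / η * KLr μ ρ = ∑ π, p π * (1 / η * KLr μ ρ) := by
    rw [← Finset.sum_mul, hp.2, one_mul]
  rw [h1, h3, avgDecKL_eq_sum, ← Finset.sum_sub_distrib]
  exact Finset.sum_congr rfl fun π _ => by ring

lemma avgDecKL_le_mixObs (hMo : ∀ i π, IsProb (Mo i π)) (hμ : IsProb μ) (f : ι → P → ℝ)
    {η : ℝ} (hη : 0 < η) {q : P → O → ℝ} (hq : ∀ π, IsProb (q π))
    (hac : ∀ i, 0 < μ i → ∀ π o, 0 < Mo i π o → 0 < q π o) {p : P → ℝ} (hp : IsProb p) :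
    avgDecKL Mo f η μ q p ≤ avgDecKL Mo f η μ (mixObs Mo μ) p := by
  rw [avgDecKL_eq_sum, avgDecKL_eq_sum]
  have hη' : 0 ≤ 1 / η := by positivity
  refine Finset.sum_le_sum fun π _ => mul_le_mul_of_nonneg_left ?_ (hp.1 π)
  exact sub_le_sub_left (mul_le_mul_of_nonneg_left
    (sum_mul_klr_mixObs_le hMo hμ (hq π) fun i hi => hac i hi π) hη') _

end Mixture

section Objective

variable {P O : Type*} [Fintype O] {M q : P → O → ℝ} {f p : P → ℝ}

lemma decKL_term_eq_bot {η : ℝ} (hη : 0 < η) {π : P} (hp : 0 < p π)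
    (h : ¬ ∀ o, 0 < M π o → 0 < q π o) :
    (p π : EReal) * ((((⨆ π', f π') - f π : ℝ) : EReal)
        - ((1 / η : ℝ) : EReal) * KLe (M π) (q π)) = ⊥ := by
  rw [kle_eq_top h, EReal.coe_mul_top_of_pos (by positivity), EReal.sub_top,
    EReal.coe_mul_bot_of_pos hp]

variable [Fintype P]

lemma decKL_objective_eq_coe (h : ∀ π o, 0 < M π o → 0 < q π o) (η : ℝ) :
    ∑ π, (p π : EReal) * ((((⨆ π', f π') - f π : ℝ) : EReal)
        - ((1 / η : ℝ) : EReal) * KLe (M π) (q π))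
      = ((∑ π, p π * (regret f π - 1 / η * KLr (M π) (q π)) : ℝ) : EReal) := by
  rw [EReal.coe_finset_sum_eq]
  refine Finset.sum_congr rfl fun π _ => ?_
  rw [kle_eq_coe_klr (h π), regret]
  norm_cast

lemma decKL_objective_eq_bot {η : ℝ} (hη : 0 < η) (hp : ∀ π, 0 < p π)
    (h : ¬ ∀ π o, 0 < M π o → 0 < q π o) :
    ∑ π, (p π : EReal) * ((((⨆ π', f π') - f π : ℝ) : EReal)
        - ((1 / η : ℝ) : EReal) * KLe (M π) (q π)) = ⊥ := by
  obtain ⟨π, hπ⟩ := not_forall.1 h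
  exact EReal.sum_eq_bot_of_mem (mem_univ π) (decKL_term_eq_bot hη (hp π) hπ)

lemma decKL_objective_le_hellinger {η : ℝ} (hη : 0 < η) (hp : IsProb p)
    (hM : ∀ π, IsProb (M π)) (hq : ∀ π, IsProb (q π)) :
    ∑ π, (p π : EReal) * ((((⨆ π', f π') - f π : ℝ) : EReal)
        - ((1 / η : ℝ) : EReal) * KLe (M π) (q π))
      ≤ ((∑ π, p π * ((⨆ π', f π') - f π - (1 / η) * Hsq (M π) (q π)) : ℝ) : EReal) := by
  rw [EReal.coe_finset_sum_eq]
  refine Finset.sum_le_sum fun π _ => ?_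
  rcases (hp.1 π).eq_or_lt with h0 | h0
  · simp [← h0]
  by_cases h : ∀ o, 0 < M π o → 0 < q π o
  · rw [kle_eq_coe_klr h]
    have hη' : 0 ≤ 1 / η := by positivity
    have := mul_le_mul_of_nonneg_left (sub_le_sub_left (mul_le_mul_of_nonneg_left
      ((hM π).hsq_le_klr (hq π) h) hη') ((⨆ π', f π') - f π)) h0.le
    exact_mod_cast this
  · rw [decKL_term_eq_bot hη h0 h]
    exact bot_le

end Objective

section Main

variable {P O ι : Type*} [Fintype P] [Nonempty P] [Fintype O] [Fintype ι]
  {Mo : ι → P → O → ℝ} {η : ℝ}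

lemma decKLgen_le_decHgen (hMo : ∀ i π, IsProb (Mo i π)) (f : ι → P → ℝ) (hη : 0 < η) :
    decKLgen (Set.range fun i => ((Mo i, f i) : ModelPair P O)) η
      ≤ decHgen (Set.range fun i => ((Mo i, f i) : ModelPair P O)) η := by
  refine iSup₂_mono fun Mb hMb => iInf₂_mono fun p hp => iSup₂_mono ?_
  rintro _ ⟨i, rfl⟩
  obtain ⟨μ, hμ, hq⟩ := exists_mixObs_of_mem_convexHull hMb
  rw [hq]
  exact decKL_objective_le_hellinger hη hp (hMo i) (isProb_mixObs hMo hμ)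

lemma iSup_iSup_iInf_mair_le_decKLgen (hMo : ∀ i π, IsProb (Mo i π)) (f : ι → P → ℝ)
    (hη : 0 < η) :
    (⨆ ρ ∈ {ρ : ι → ℝ | IsProb ρ ∧ ∀ m, 0 < ρ m},
        ⨆ μ ∈ {μ : ι → ℝ | IsProb μ},
          ⨅ p ∈ {p : P → ℝ | IsProb p}, ((MAIR Mo f ρ p η μ : ℝ) : EReal))
      ≤ decKLgen (Set.range fun i => ((Mo i, f i) : ModelPair P O)) η := by
  refine iSup₂_le fun ρ hρ => iSup₂_le fun μ hμ => ?_
  refine le_iSup₂_of_le _ (mixture_mem_convexHull hμ) (iInf₂_mono fun p hp => ?_)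
  rw [fst_mixture, mair_eq hMo hμ hρ.2 f η hp]
  have hval : ∃ i, 0 < μ i ∧ avgDecKL Mo f η μ (mixObs Mo μ) p
      ≤ ∑ π, p π * (regret (f i) π - 1 / η * KLr (Mo i π) (mixObs Mo μ π)) := by
    by_contra! hlt
    obtain ⟨i, -, hi⟩ := Finset.exists_lt_of_sum_lt (s := univ) (f := fun _ : ι => (0 : ℝ))
      (g := μ) (by simp [hμ.2])
    have hsum : avgDecKL Mo f η μ (mixObs Mo μ) p
        < ∑ j, μ j * avgDecKL Mo f η μ (mixObs Mo μ) p := by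
      refine Finset.sum_lt_sum (fun j _ => ?_) ⟨i, mem_univ i, mul_lt_mul_of_pos_left (hlt i hi) hi⟩
      rcases (hμ.1 j).eq_or_lt with hj | hj
      · simp [← hj]
      · exact (mul_lt_mul_of_pos_left (hlt j hj) hj).le
    rw [← Finset.sum_mul, hμ.2, one_mul] at hsum
    exact hsum.false
  obtain ⟨i, hi, hle⟩ := hval
  refine le_iSup₂_of_le (Mo i, f i) ⟨i, rfl⟩ ?_
  rw [decKL_objective_eq_coe fun π o ho => mixObs_pos hMo hμ hi ho, EReal.coe_le_coe_iff]
  have hKL : 0 ≤ 1 / η * KLr μ ρ :=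
    mul_nonneg (by positivity) (IsProb.klr_nonneg hμ hρ.1 fun j _ => hρ.2 j)
  linarith

lemma decKLgen_le_iSup_iSup_iInf_mair (hMo : ∀ i π, IsProb (Mo i π)) (f : ι → P → ℝ)
    (hη : 0 < η) :
    decKLgen (Set.range fun i => ((Mo i, f i) : ModelPair P O)) η ≤
      ⨆ ρ ∈ {ρ : ι → ℝ | IsProb ρ ∧ ∀ m, 0 < ρ m},
        ⨆ μ ∈ {μ : ι → ℝ | IsProb μ},
          ⨅ p ∈ {p : P → ℝ | IsProb p}, ((MAIR Mo f ρ p η μ : ℝ) : EReal) := by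
  refine iSup₂_le fun Mb hMb => ?_
  obtain ⟨μ₀, hμ₀, hq⟩ := exists_mixObs_of_mem_convexHull hMb
  rw [hq]
  have hne : ∃ i, ∀ π o, 0 < Mo i π o → 0 < mixObs Mo μ₀ π o := by
    obtain ⟨i, -, hi⟩ := Finset.exists_lt_of_sum_lt (s := univ) (f := fun _ : ι => (0 : ℝ))
      (g := μ₀) (by simp [hμ₀.2])
    exact ⟨i, fun π o ho => mixObs_pos hMo hμ₀ hi ho⟩
  have : Nonempty ι := hne.nonempty
  obtain ⟨v, p, μ, hp, hμ, hsupp, hle, hge⟩ := exists_matrix_game_value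
    (fun i π => regret (f i) π - 1 / η * KLr (Mo i π) (mixObs Mo μ₀ π)) hne
  refine le_trans (b := (v : EReal)) ?_ ?_
  · refine EReal.le_of_forall_lt_iff_le.1 fun z hz => ?_
    obtain ⟨p', hp', hpos, hz'⟩ := exists_pos_isProb_le _ hp hle (EReal.coe_lt_coe_iff.1 hz)
    refine iInf₂_le_of_le p' hp' (iSup₂_le ?_)
    rintro _ ⟨i, rfl⟩
    by_cases hi : ∀ π o, 0 < Mo i π o → 0 < mixObs Mo μ₀ π o
    · rw [decKL_objective_eq_coe hi]
      exact_mod_cast hz' i hi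
    · rw [decKL_objective_eq_bot hη hpos hi]
      exact bot_le
  · refine EReal.ge_of_forall_gt_iff_ge.1 fun z hz => ?_
    have hzv : 0 < v - z := sub_pos.2 (EReal.coe_lt_coe_iff.1 hz)
    obtain ⟨ρ, hρ, hρpos, hKL⟩ := hμ.exists_pos_klr_le (mul_pos hη hzv)
    refine le_iSup₂_of_le ρ ⟨hρ, hρpos⟩ (le_iSup₂_of_le μ hμ (le_iInf₂ fun p' hp' => ?_))
    rw [mair_eq hMo hμ hρpos f η hp', EReal.coe_le_coe_iff]
    have h1 := avgDecKL_le_mixObs hMo hμ f hη (isProb_mixObs hMo hμ₀) hsupp hp'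
    have h2 : v ≤ avgDecKL Mo f η μ (mixObs Mo μ₀) p' := hge p' hp'
    have h3 : 1 / η * KLr μ ρ ≤ v - z := by
      rw [one_div_mul_eq_div, div_le_iff₀ hη]
      linarith
    linarith

end Main

/-- Bounding MAIR by DEC: for every `η > 0`,
`sup_{ρ ∈ int Δ(𝓜)} sup_{μ ∈ Δ(𝓜)} inf_{p ∈ Δ(Π)} MAIR_{ρ,η}(p,μ)
  = DEC^KL_η(𝓜) ≤ DEC_η(𝓜)`. -/
theorem mair_maximin_eq_decKL
    {P O ι : Type*} [Fintype P] [Nonempty P] [Fintype O] [Nonempty O]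
    [Fintype ι] [Nonempty ι]
    (Mo : ι → P → O → ℝ) (hMo : ∀ i π, IsProb (Mo i π))
    (f : ι → P → ℝ) (η : ℝ) (hη : 0 < η) :
    (⨆ ρ ∈ {ρ : ι → ℝ | IsProb ρ ∧ ∀ m, 0 < ρ m},
        ⨆ μ ∈ {μ : ι → ℝ | IsProb μ},
          ⨅ p ∈ {p : P → ℝ | IsProb p}, ((MAIR Mo f ρ p η μ : ℝ) : EReal))
        = decKLgen (Set.range fun i => ((Mo i, f i) : ModelPair P O)) η ∧
    decKLgen (Set.range fun i => ((Mo i, f i) : ModelPair P O)) η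
      ≤ decHgen (Set.range fun i => ((Mo i, f i) : ModelPair P O)) η := by
  exact ⟨le_antisymm (iSup_iSup_iInf_mair_le_decKLgen hMo f hη)
    (decKLgen_le_iSup_iSup_iInf_mair hMo f hη), decKLgen_le_decHgen hMo f hη⟩
end

section
/- Generic regret bound for an arbitrary learning algorithm: suppose algorithmic beliefs are generated by maximizing AIR along each history: q_1 is the uniform distribution on Π; for each t ≤ T and each history h_{t−1}, ν_t(h_{t−1}) ∈ Δ(𝓜×Π) maximizes ν ↦ AIR_{q_t(h_{t−1}),η}(p_t(h_{t−1}),ν) over Δ(𝓜×Π), and q_{t+1}(h_t) := (ν_t(h_{t−1}))_{π*|π_t,o_t}. Assume the maximizers are chosen so that for every history h_{t−1} of positive P-probability, every π ∈ Π with p_t(h_{t−1})(π) > 0, and every o ∈ O, one has m_{ν_t(h_{t−1})}(π,o) > 0 and the posterior (ν_t(h_{t−1}))_{π*|π,o} has all coordinates strictly positive. Then sup_{π̄∈Π} E_P[ Σ_{t=1}^T ( f_{M_t(h_{t−1})}(π̄) − f_{M_t(h_{t−1})}(π_t) ) ] ≤ log|Π|/η + E_P[ Σ_{t=1}^T AIR_{q_t(h_{t−1}),η}(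 p_t(h_{t−1}), ν_t(h_{t−1}) ) ]. -/
open Finset

/-- Truncation of a history of length `k` to its first `j ≤ k` entries. -/
def trunc {α : Type*} {k : ℕ} (h : Fin k → α) (j : ℕ) (hj : j ≤ k) : Fin j → α :=
  fun s => h ⟨s.1, lt_of_lt_of_le s.2 hj⟩

/-- Probability, under the interaction of algorithm `palg` with the adaptive
adversarial environment `env` (with observation kernels `Mo`), of a history of
length `k ≤ T`:  `∏_{s<k} p_{s+1}(h_s)(π_{s+1})·[M_{s+1}(h_s)(π_{s+1})](o_{s+1})`. -/
noncomputable def ProbHist {M P O : Type*} [Fintype M] [Fintype P] [Fintype O]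
    (Mo : M → P → O → ℝ) {T : ℕ}
    (palg : (t : Fin T) → (Fin t.1 → P × O) → P → ℝ)
    (env : (t : Fin T) → (Fin t.1 → P × O) → M)
    (k : ℕ) (hk : k ≤ T) (h : Fin k → P × O) : ℝ :=
  ∏ s : Fin k,
    palg ⟨s.1, lt_of_lt_of_le s.2 hk⟩ (trunc h s.1 (le_of_lt s.2)) (h s).1 *
      Mo (env ⟨s.1, lt_of_lt_of_le s.2 hk⟩ (trunc h s.1 (le_of_lt s.2))) (h s).1 (h s).2

section OneStep

variable {M P O : Type*} [Fintype M] [Fintype P] [Fintype O]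

/-- Gibbs' inequality, in the form used to compare two log-ratios against the same reference. -/
lemma sum_mul_log_div_le {S : Type*} [Fintype S] {p r q : S → ℝ} (hp : ∀ x, 0 < p x)
    (hr : ∀ x, 0 < r x) (hq : ∀ x, 0 < q x) (hsum : ∑ x, r x ≤ ∑ x, p x) :
    ∑ x, p x * Real.log (r x / q x) ≤ ∑ x, p x * Real.log (p x / q x) := by
  have key : ∀ x, p x * Real.log (r x / q x) - p x * Real.log (p x / q x) ≤ r x - p x := by
    intro x
    have h := Real.log_le_sub_one_of_pos (div_pos (hr x) (hp x))
    rw [Real.log_div (hr x).ne' (hp x).ne'] at h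
    rw [Real.log_div (hr x).ne' (hq x).ne', Real.log_div (hp x).ne' (hq x).ne']
    have h2 := mul_le_mul_of_nonneg_left h (hp x).le
    have h3 : p x * (r x / p x - 1) = r x - p x := by
      have := (hp x).ne'
      field_simp
    linarith
  have h := Finset.sum_le_sum fun x (_ : x ∈ univ) => key x
  rw [Finset.sum_sub_distrib, Finset.sum_sub_distrib] at h
  linarith

lemma mObs_eq_sum (Mo : M → P → O → ℝ) (ν : M × P → ℝ) (π : P) (o : O) :
    mObs Mo ν π o = ∑ π', ∑ m, ν (m, π') * Mo m π o := by
  rw [mObs, Fintype.sum_prod_type_right]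

lemma sum_post {Mo : M → P → O → ℝ} {ν : M × P → ℝ} {π : P} {o : O}
    (h : mObs Mo ν π o ≠ 0) : ∑ π', post Mo ν π o π' = 1 := by
  simp only [post]
  rw [← Finset.sum_div, ← mObs_eq_sum, div_self h]

lemma post_nonneg {Mo : M → P → O → ℝ} (hMo : ∀ m π o, 0 ≤ Mo m π o) {ν : M × P → ℝ}
    (hν : ∀ x, 0 ≤ ν x) (π : P) (o : O) (π' : P) : 0 ≤ post Mo ν π o π' :=
  div_nonneg (Finset.sum_nonneg fun _ _ => mul_nonneg (hν _) (hMo _ _ _))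
    (Finset.sum_nonneg fun _ _ => mul_nonneg (hν _) (hMo _ _ _))

lemma post_le_one {Mo : M → P → O → ℝ} (hMo : ∀ m π o, 0 ≤ Mo m π o) {ν : M × P → ℝ}
    (hν : ∀ x, 0 ≤ ν x) (π : P) (o : O) (π' : P) : post Mo ν π o π' ≤ 1 := by
  refine div_le_one_of_le₀ ?_ (Finset.sum_nonneg fun _ _ => mul_nonneg (hν _) (hMo _ _ _))
  rw [mObs_eq_sum]
  exact Finset.single_le_sum (f := fun π' => ∑ m, ν (m, π') * Mo m π o)
    (fun _ _ => Finset.sum_nonneg fun _ _ => mul_nonneg (hν _) (hMo _ _ _)) (mem_univ π')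

lemma sum_mul_comp_snd {Mo : M → P → O → ℝ} (hMo : ∀ m π o, 0 ≤ Mo m π o) {ν : M × P → ℝ}
    (hν : ∀ x, 0 ≤ ν x) (π : P) (o : O) (g : P → ℝ) :
    ∑ x : M × P, ν x * Mo x.1 π o * g x.2
      = mObs Mo ν π o * ∑ π', post Mo ν π o π' * g π' := by
  have hterm : ∀ x ∈ (univ : Finset (M × P)), 0 ≤ ν x * Mo x.1 π o :=
    fun _ _ => mul_nonneg (hν _) (hMo _ _ _)
  by_cases h : mObs Mo ν π o = 0
  · have h0 := (Finset.sum_eq_zero_iff_of_nonneg hterm).1 h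
    rw [h, zero_mul]
    exact Finset.sum_eq_zero fun x hx => by rw [h0 x hx, zero_mul]
  · rw [Fintype.sum_prod_type_right, Finset.mul_sum]
    refine Finset.sum_congr rfl fun π' _ => ?_
    simp only [post]
    rw [← Finset.sum_mul]
    field_simp

/-- The information ratio of the pair `x = (M, π̄)` when posteriors are replaced by an arbitrary
estimator `R` of the optimal decision. -/
noncomputable def pointAIR (Mo : M → P → O → ℝ) (f : M → P → ℝ) (q p : P → ℝ) (η : ℝ)
    (R : P → O → P → ℝ) (x : M × P) : ℝ :=
  ∑ π, ∑ o, p π * Mo x.1 π o *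
    (f x.1 x.2 - f x.1 π - (1 / η) * Real.log (R π o x.2 / q x.2))

lemma sum_mul_pointAIR (Mo : M → P → O → ℝ) (f : M → P → ℝ) (q p : P → ℝ) (η : ℝ)
    (R : P → O → P → ℝ) (ν : M × P → ℝ) :
    ∑ x, ν x * pointAIR Mo f q p η R x
      = ∑ π, ∑ o, (∑ x : M × P, ν x * p π * Mo x.1 π o * (f x.1 x.2 - f x.1 π)
          - (1 / η) * (p π * ∑ x : M × P, ν x * Mo x.1 π o * Real.log (R π o x.2 / q x.2))) := by
  simp only [pointAIR, Finset.mul_sum]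
  rw [Finset.sum_comm]
  refine Finset.sum_congr rfl fun π _ => ?_
  rw [Finset.sum_comm]
  refine Finset.sum_congr rfl fun o _ => ?_
  rw [← Finset.sum_sub_distrib]
  exact Finset.sum_congr rfl fun x _ => by ring

lemma AIR_eq_sum (Mo : M → P → O → ℝ) (f : M → P → ℝ) (q p : P → ℝ) (η : ℝ)
    (ν : M × P → ℝ) :
    AIR Mo f q p η ν
      = ∑ π, ∑ o, (∑ x : M × P, ν x * p π * Mo x.1 π o * (f x.1 x.2 - f x.1 π)
          - (1 / η) * (p π * (mObs Mo ν π o * KLr (post Mo ν π o) q))) := by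
  simp only [AIR]
  rw [Finset.sum_comm]
  refine Finset.sum_congr rfl fun π _ => ?_
  rw [Finset.sum_comm]
  refine Finset.sum_congr rfl fun o _ => ?_
  rw [mObs, Finset.sum_mul, Finset.mul_sum, Finset.mul_sum, ← Finset.sum_sub_distrib]
  exact Finset.sum_congr rfl fun x _ => by ring

lemma AIR_eq_sum_pointAIR {Mo : M → P → O → ℝ} (hMo : ∀ m π o, 0 ≤ Mo m π o) (f : M → P → ℝ)
    (q p : P → ℝ) (η : ℝ) {ν : M × P → ℝ} (hν : ∀ x, 0 ≤ ν x) :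
    AIR Mo f q p η ν = ∑ x, ν x * pointAIR Mo f q p η (post Mo ν) x := by
  rw [AIR_eq_sum, sum_mul_pointAIR]
  refine Finset.sum_congr rfl fun π _ => Finset.sum_congr rfl fun o _ => ?_
  rw [sum_mul_comp_snd hMo hν π o fun π' => Real.log (post Mo ν π o π' / q π'), KLr]

/-- The true posterior minimizes the estimator form of the information ratio. -/
lemma AIR_le_sum_pointAIR {Mo : M → P → O → ℝ} (hMo : ∀ m π o, 0 ≤ Mo m π o) (f : M → P → ℝ)
    {q p : P → ℝ} {η : ℝ} (hη : 0 < η) (hq : ∀ π, 0 < q π) (hp : ∀ π, 0 ≤ p π)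
    {ν : M × P → ℝ} (hν : ∀ x, 0 ≤ ν x) {R : P → O → P → ℝ}
    (hpos : ∀ π, 0 < p π → ∀ o, 0 < mObs Mo ν π o ∧ ∀ π', 0 < post Mo ν π o π')
    (hR : ∀ π, 0 < p π → ∀ o, (∀ π', 0 < R π o π') ∧ ∑ π', R π o π' = 1) :
    AIR Mo f q p η ν ≤ ∑ x, ν x * pointAIR Mo f q p η R x := by
  rw [AIR_eq_sum, sum_mul_pointAIR]
  refine Finset.sum_le_sum fun π _ => Finset.sum_le_sum fun o _ => ?_
  rcases (hp π).eq_or_lt with h0 | h0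
  · simp [← h0]
  rw [sum_mul_comp_snd hMo hν π o fun π' => Real.log (R π o π' / q π'), KLr]
  obtain ⟨hm, hpost⟩ := hpos π h0 o
  obtain ⟨hR0, hR1⟩ := hR π h0 o
  have := sum_mul_log_div_le hpost hR0 hq (by rw [hR1, sum_post hm.ne'])
  gcongr

/-- First-order optimality of an AIR-maximizing belief, tested against the point mass at `x`. -/
lemma pointAIR_post_le_AIR {Mo : M → P → O → ℝ} (hMo : ∀ m π o, 0 ≤ Mo m π o)
    (f : M → P → ℝ) {q p : P → ℝ} {η : ℝ} (hη : 0 < η) (hq : ∀ π, 0 < q π)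
    (hp : ∀ π, 0 ≤ p π) {ν : M × P → ℝ} (hν : IsProb ν)
    (hmax : ∀ ν' : M × P → ℝ, IsProb ν' → AIR Mo f q p η ν' ≤ AIR Mo f q p η ν)
    (hpos : ∀ π, 0 < p π → ∀ o, 0 < mObs Mo ν π o ∧ ∀ π', 0 < post Mo ν π o π')
    (x : M × P) :
    pointAIR Mo f q p η (post Mo ν) x ≤ AIR Mo f q p η ν := by
  classical
  set mix : ℝ → M × P → ℝ := fun ε y => (1 - ε) * ν y + ε * (if y = x then 1 else 0) with hmix
  have mix_zero : mix 0 = ν := by ext y; simp [hmix]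
  have mix_nonneg : ∀ ε, 0 < ε → ε < 1 → ∀ y, 0 ≤ mix ε y := fun ε h0 h1 y =>
    add_nonneg (mul_nonneg (by linarith) (hν.1 y)) (mul_nonneg h0.le (by split_ifs <;> simp))
  have sum_mix : ∀ ε (g : M × P → ℝ),
      ∑ y, mix ε y * g y = (1 - ε) * ∑ y, ν y * g y + ε * g x := by
    intro ε g
    simp [hmix, add_mul, Finset.sum_add_distrib, Finset.mul_sum, mul_assoc]
  have mix_prob : ∀ ε, 0 < ε → ε < 1 → IsProb (mix ε) := by
    intro ε h0 h1
    refine ⟨mix_nonneg ε h0 h1, ?_⟩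
    have := sum_mix ε fun _ => 1
    simp only [mul_one, hν.2] at this
    rw [this]; ring
  have post_mix_pos : ∀ ε, 0 < ε → ε < 1 → ∀ π, 0 < p π → ∀ o,
      (∀ π', 0 < post Mo (mix ε) π o π') ∧ ∑ π', post Mo (mix ε) π o π' = 1 := by
    intro ε h0 h1 π hπ o
    obtain ⟨hm, hpost⟩ := hpos π hπ o
    have hmm : 0 < mObs Mo (mix ε) π o := by
      rw [mObs, sum_mix ε fun y => Mo y.1 π o]
      exact add_pos_of_pos_of_nonneg (mul_pos (by linarith) hm) (mul_nonneg h0.le (hMo _ _ _))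
    refine ⟨fun π' => div_pos ?_ hmm, sum_post hmm.ne'⟩
    have hnum : 0 < ∑ m, ν (m, π') * Mo m π o := (div_pos_iff_of_pos_right hm).1 (hpost π')
    refine (mul_pos (sub_pos.2 h1) hnum).trans_le ?_
    rw [Finset.mul_sum]
    refine Finset.sum_le_sum fun m _ => ?_
    rw [← mul_assoc]
    refine mul_le_mul_of_nonneg_right ?_ (hMo _ _ _)
    exact le_add_of_nonneg_right (mul_nonneg h0.le (by split_ifs <;> simp))
  have upper : ∀ ε, 0 < ε → ε < 1 →
      pointAIR Mo f q p η (post Mo (mix ε)) x ≤ AIR Mo f q p η ν := by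
    intro ε h0 h1
    have e1 := hmax _ (mix_prob ε h0 h1)
    rw [AIR_eq_sum_pointAIR hMo f q p η (mix_nonneg ε h0 h1), sum_mix] at e1
    have e2 := mul_le_mul_of_nonneg_left
      (AIR_le_sum_pointAIR hMo f hη hq hp hν.1 hpos (post_mix_pos ε h0 h1)) (sub_pos.2 h1).le
    have e3 : ε * pointAIR Mo f q p η (post Mo (mix ε)) x ≤ ε * AIR Mo f q p η ν := by linarith
    exact le_of_mul_le_mul_left e3 h0
  have cont : ContinuousAt (fun ε => pointAIR Mo f q p η (post Mo (mix ε)) x) 0 := by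
    unfold pointAIR
    refine tendsto_finsetSum _ fun π _ => tendsto_finsetSum _ fun o _ => ?_
    rcases (hp π).eq_or_lt with h0 | h0
    · simp [← h0]
    obtain ⟨hm, hpost⟩ := hpos π h0 o
    have hc : ContinuousAt (fun ε => post Mo (mix ε) π o x.2) 0 := by
      unfold post mObs
      refine ContinuousAt.div (by fun_prop) (by fun_prop) ?_
      rw [mix_zero]
      exact hm.ne'
    refine ContinuousAt.mul continuousAt_const (continuousAt_const.sub
      (continuousAt_const.mul ((hc.div_const _).log ?_)))
    rw [mix_zero]
    exact (div_pos (hpost _) (hq _)).ne'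
  have lim := cont.tendsto
  rw [mix_zero] at lim
  refine le_of_tendsto (lim.mono_left (nhdsWithin_le_nhds (s := Set.Ioi 0))) ?_
  filter_upwards [Ioo_mem_nhdsGT (zero_lt_one' ℝ)] with ε hε using upper ε hε.1 hε.2

end OneStep

section Histories

variable {α : Type*}

/-- Weight of a history under a family of conditional weights `w`. -/
noncomputable def histWeight {T : ℕ} (w : (t : Fin T) → (Fin t.1 → α) → α → ℝ) (k : ℕ)
    (hk : k ≤ T) (h : Fin k → α) : ℝ :=
  ∏ s : Fin k, w ⟨s.1, lt_of_lt_of_le s.2 hk⟩ (trunc h s.1 (le_of_lt s.2)) (h s)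

lemma trunc_snoc {k : ℕ} (h : Fin k → α) (a : α) (j : ℕ) (hj : j ≤ k) :
    trunc (Fin.snoc h a : Fin (k + 1) → α) j (hj.trans k.le_succ) = trunc h j hj := by
  ext s
  exact Fin.snoc_castSucc (α := fun _ => α) a h ⟨s.1, lt_of_lt_of_le s.2 hj⟩

lemma trunc_self {k : ℕ} (h : Fin k → α) : trunc h k le_rfl = h := rfl

lemma sum_snoc [Fintype α] {k : ℕ} (g : (Fin (k + 1) → α) → ℝ) :
    ∑ h, g h = ∑ h : Fin k → α, ∑ a, g (Fin.snoc h a) := by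
  rw [← (Fin.snocEquiv fun _ => α).sum_comp, Fintype.sum_prod_type_right]
  rfl

lemma histWeight_snoc {T : ℕ} (w : (t : Fin T) → (Fin t.1 → α) → α → ℝ) (k : ℕ)
    (hk : k + 1 ≤ T) (h : Fin k → α) (a : α) :
    histWeight w (k + 1) hk (Fin.snoc h a)
      = histWeight w k (k.le_succ.trans hk) h * w ⟨k, hk⟩ h a := by
  rw [histWeight, Fin.prod_univ_castSucc, histWeight]
  simp only [Fin.val_castSucc, Fin.snoc_castSucc, Fin.val_last, Fin.snoc_last]
  congr 1
  · exact Finset.prod_congr rfl fun s _ => by rw [trunc_snoc _ _ _ s.2.le]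
  · rw [trunc_snoc _ _ _ le_rfl, trunc_self]

lemma histWeight_nonneg {T : ℕ} {w : (t : Fin T) → (Fin t.1 → α) → α → ℝ}
    (hw : ∀ t h a, 0 ≤ w t h a) (k : ℕ) (hk : k ≤ T) (h : Fin k → α) :
    0 ≤ histWeight w k hk h :=
  Finset.prod_nonneg fun _ _ => hw _ _ _

/-- A potential `Φ` that pays, in conditional expectation, for the cost `c` of each step bounds
the total expected cost. -/
lemma sum_histWeight_mul_le [Fintype α] {T : ℕ} {w : (t : Fin T) → (Fin t.1 → α) → α → ℝ}
    (hw : ∀ t h a, 0 ≤ w t h a) (hw1 : ∀ t h, ∑ a, w t h a = 1)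
    (c : (t : Fin T) → (Fin t.1 → α) → α → ℝ) (Φ : (k : ℕ) → k ≤ T → (Fin k → α) → ℝ) (B : ℝ)
    (hΦ0 : ∀ h, Φ 0 T.zero_le h ≤ B)
    (hstep : ∀ (t : Fin T) (h : Fin t.1 → α), 0 < histWeight w t.1 t.2.le h →
      ∑ a, w t h a * (c t h a + Φ (t.1 + 1) t.2 (Fin.snoc h a)) ≤ Φ t.1 t.2.le h)
    (k : ℕ) (hk : k ≤ T) :
    ∑ h : Fin k → α, histWeight w k hk h *
      (∑ s : Fin k, c ⟨s.1, lt_of_lt_of_le s.2 hk⟩ (trunc h s.1 s.2.le) (h s) + Φ k hk h)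
      ≤ B := by
  induction k with
  | zero => simpa [histWeight] using hΦ0 default
  | succ k ih =>
    refine le_trans ?_ (ih (k.le_succ.trans hk))
    rw [sum_snoc]
    refine Finset.sum_le_sum fun h _ => ?_
    simp only [histWeight_snoc]
    have hcost : ∀ a, ∑ s : Fin (k + 1), c ⟨s.1, lt_of_lt_of_le s.2 hk⟩
          (trunc (Fin.snoc h a : Fin (k + 1) → α) s.1 s.2.le)
          ((Fin.snoc h a : Fin (k + 1) → α) s)
        = ∑ s : Fin k, c ⟨s.1, lt_of_lt_of_le s.2 (k.le_succ.trans hk)⟩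
            (trunc h s.1 s.2.le) (h s) + c ⟨k, hk⟩ h a := by
      intro a
      rw [Fin.sum_univ_castSucc]
      simp only [Fin.val_castSucc, Fin.snoc_castSucc, Fin.val_last, Fin.snoc_last]
      congr 1
      · exact Finset.sum_congr rfl fun s _ => by rw [trunc_snoc _ _ _ s.2.le]
      · rw [trunc_snoc _ _ _ le_rfl, trunc_self]
    simp only [hcost, mul_assoc]
    rw [← Finset.mul_sum]
    rcases (histWeight_nonneg hw k (k.le_succ.trans hk) h).eq_or_lt with h0 | h0
    · simp [← h0]
    refine mul_le_mul_of_nonneg_left ?_ h0.le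
    simp only [add_assoc]
    simp only [mul_add (w _ _ _) (∑ s : Fin k, _) _]
    rw [Finset.sum_add_distrib, ← Finset.sum_mul, hw1, one_mul]
    exact add_le_add_right (hstep ⟨k, hk⟩ h h0) _

end Histories

/-- The reference distribution after `k` rounds: uniform at the start, then the posterior of the
latest belief. -/
noncomputable def reference {M P O : Type*} [Fintype M] [Fintype P] [Fintype O]
    (Mo : M → P → O → ℝ) {T : ℕ} (ν : (t : Fin T) → (Fin t.1 → P × O) → M × P → ℝ) :
    (k : ℕ) → k ≤ T → (Fin k → P × O) → P → ℝ
  | 0, _, _ => fun _ => 1 / Fintype.card P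
  | k + 1, hk, h =>
    post Mo (ν ⟨k, hk⟩ (trunc h k k.le_succ)) (h (Fin.last k)).1 (h (Fin.last k)).2

/-- Generic regret bound for an arbitrary learning algorithm: if at each round the
algorithmic belief `ν_t(h_{t−1})` maximizes `ν ↦ AIR_{q_t(h_{t−1}),η}(p_t(h_{t−1}),ν)`
over `Δ(𝓜×Π)`, where `q_1` is uniform and `q_{t+1}(h_t)` is the marginal posterior of
`ν_t(h_{t−1})` at `(π_t,o_t)`, and the posteriors along reachable histories are
well-defined and strictly positive, then
`sup_π̄ E_P[Σ_t (f_{M_t}(π̄) − f_{M_t}(π_t))] ≤ log|Π|/η + E_P[Σ_t AIR_{q_t,η}(p_t,ν_t)]`. -/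
theorem generic_regret_bound
    {M P O : Type*} [Fintype M] [Nonempty M]
    [Fintype P] [Nonempty P] [DecidableEq P]
    [Fintype O] [Nonempty O] [DecidableEq O]
    (T : ℕ) (η : ℝ) (hη : 0 < η)
    (Mo : M → P → O → ℝ) (hMo : ∀ m π, IsProb (Mo m π))
    (f : M → P → ℝ)
    (palg : (t : Fin T) → (Fin t.1 → P × O) → P → ℝ)
    (hpalg : ∀ t h, IsProb (palg t h))
    (env : (t : Fin T) → (Fin t.1 → P × O) → M)
    (q : (t : Fin T) → (Fin t.1 → P × O) → P → ℝ)
    (ν : (t : Fin T) → (Fin t.1 → P × O) → M × P → ℝ)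
    (hq0 : ∀ (t : Fin T), t.1 = 0 → ∀ (h : Fin t.1 → P × O) (π : P),
      q t h π = 1 / Fintype.card P)
    (hqsucc : ∀ (t : Fin T) (ht : t.1 + 1 < T) (h : Fin (t.1 + 1) → P × O),
      q ⟨t.1 + 1, ht⟩ h
        = post Mo (ν t (trunc h t.1 (Nat.le_succ _)))
            (h ⟨t.1, Nat.lt_succ_self _⟩).1 (h ⟨t.1, Nat.lt_succ_self _⟩).2)
    (hνprob : ∀ t h, IsProb (ν t h))
    (hνmax : ∀ (t : Fin T) (h : Fin t.1 → P × O) (ν' : M × P → ℝ), IsProb ν' →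
      AIR Mo f (q t h) (palg t h) η ν' ≤ AIR Mo f (q t h) (palg t h) η (ν t h))
    (hpos : ∀ (t : Fin T) (h : Fin t.1 → P × O),
      0 < ProbHist Mo palg env t.1 (le_of_lt t.2) h →
      ∀ π, 0 < palg t h π → ∀ o : O,
        0 < mObs Mo (ν t h) π o ∧ ∀ π', 0 < post Mo (ν t h) π o π') :
    (⨆ πb : P, ∑ τ : Fin T → P × O, ProbHist Mo palg env T le_rfl τ *
        ∑ t : Fin T, (f (env t (trunc τ t.1 (le_of_lt t.2))) πb
          - f (env t (trunc τ t.1 (le_of_lt t.2))) (τ t).1))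
      ≤ Real.log (Fintype.card P) / η
        + ∑ τ : Fin T → P × O, ProbHist Mo palg env T le_rfl τ *
            ∑ t : Fin T, AIR Mo f (q t (trunc τ t.1 (le_of_lt t.2)))
              (palg t (trunc τ t.1 (le_of_lt t.2))) η (ν t (trunc τ t.1 (le_of_lt t.2))) := by
  have hMo0 : ∀ m π o, 0 ≤ Mo m π o := fun m π => (hMo m π).1
  set w : (t : Fin T) → (Fin t.1 → P × O) → P × O → ℝ :=
    fun t h a => palg t h a.1 * Mo (env t h) a.1 a.2 with hwdef
  have hw : ∀ t h a, 0 ≤ w t h a := fun t h a => mul_nonneg ((hpalg t h).1 _) (hMo0 _ _ _)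
  have hw1 : ∀ t h, ∑ a, w t h a = 1 := by
    intro t h
    simp only [hwdef, Fintype.sum_prod_type, ← Finset.mul_sum, (hMo _ _).2, mul_one, (hpalg t h).2]
  have hprob : ∀ k hk h, ProbHist Mo palg env k hk h = histWeight w k hk h :=
    fun _ _ _ => rfl
  have href : ∀ t h, q t h = reference Mo ν t.1 t.2.le h := by
    rintro ⟨_ | k, ht⟩ h
    · exact funext fun π => hq0 ⟨0, ht⟩ rfl h π
    · exact hqsucc ⟨k, k.lt_succ_self.trans ht⟩ ht h
  have hcard : (0 : ℝ) < Fintype.card P := Nat.cast_pos.2 Fintype.card_pos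
  have href_pos : ∀ k hk h, 0 < histWeight w k hk h → ∀ π, 0 < reference Mo ν k hk h π := by
    rintro (_ | k) hk h hh π
    · exact one_div_pos.2 hcard
    · rw [← Fin.snoc_init_self h, histWeight_snoc] at hh
      have hprev := pos_of_mul_pos_left hh (hw _ _ _)
      have hlast := pos_of_mul_pos_right hh (histWeight_nonneg hw _ _ _)
      exact (hpos ⟨k, hk⟩ (Fin.init h) hprev _
        (pos_of_mul_pos_left hlast (hMo0 _ _ _)) _).2 π
  refine ciSup_le fun πb => ?_
  have hfinal := sum_histWeight_mul_le hw hw1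
    (fun t h a => f (env t h) πb - f (env t h) a.1 - AIR Mo f (q t h) (palg t h) η (ν t h))
    (fun k hk h => -(1 / η * Real.log (reference Mo ν k hk h πb)))
    (Real.log (Fintype.card P) / η)
    (fun h => by
      simp only [reference, one_div, Real.log_inv]
      apply le_of_eq
      ring)
    (by
      intro t h hh
      have hqp : ∀ π, 0 < q t h π := by rw [href]; exact href_pos _ _ _ hh
      have hone := pointAIR_post_le_AIR hMo0 f hη hqp (hpalg t h).1 (hνprob t h) (hνmax t h)
        (hpos t h hh) (env t h, πb)
      have hnew : ∀ a, reference Mo ν (t.1 + 1) t.2 (Fin.snoc h a)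
          = post Mo (ν t h) a.1 a.2 := by
        intro a
        simp only [reference, Fin.snoc_last]
        rw [trunc_snoc _ _ _ le_rfl, trunc_self]
      have hsum : ∑ a, w t h a * (f (env t h) πb - f (env t h) a.1
            - AIR Mo f (q t h) (palg t h) η (ν t h)
            + -(1 / η * Real.log (post Mo (ν t h) a.1 a.2 πb)))
          = pointAIR Mo f (q t h) (palg t h) η (post Mo (ν t h)) (env t h, πb)
            - AIR Mo f (q t h) (palg t h) η (ν t h)
            - 1 / η * Real.log (q t h πb) := by
        have e : pointAIR Mo f (q t h) (palg t h) η (post Mo (ν t h)) (env t h, πb)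
            = ∑ a, w t h a * (f (env t h) πb - f (env t h) a.1
              - 1 / η * Real.log (post Mo (ν t h) a.1 a.2 πb / q t h πb)) := by
          rw [Fintype.sum_prod_type]
          rfl
        have avg : ∀ C : ℝ, ∑ a, w t h a * C = C := fun C => by
          rw [← Finset.sum_mul, hw1, one_mul]
        rw [e]
        conv_rhs =>
          rw [← avg (AIR Mo f (q t h) (palg t h) η (ν t h)),
            ← avg (1 / η * Real.log (q t h πb)),
            ← Finset.sum_sub_distrib, ← Finset.sum_sub_distrib]
        refine Finset.sum_congr rfl fun a _ => ?_
        rcases (hw t h a).eq_or_lt with h0 | h0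
        · simp [← h0]
        · have hpa := pos_of_mul_pos_left h0 (hMo0 _ _ _)
          rw [Real.log_div ((hpos t h hh _ hpa _).2 _).ne' (hqp _).ne']
          ring
      simp only [hnew]
      rw [hsum, ← href]
      linarith)
    T le_rfl
  rw [← sub_le_iff_le_add, ← Finset.sum_sub_distrib]
  refine le_trans (Finset.sum_le_sum fun τ _ => ?_) hfinal
  rw [← mul_sub, ← Finset.sum_sub_distrib, hprob]
  refine mul_le_mul_of_nonneg_left (le_add_of_nonneg_right ?_) (histWeight_nonneg hw _ _ _)
  rw [Left.nonneg_neg_iff]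
  refine mul_nonpos_of_nonneg_of_nonpos (one_div_pos.2 hη).le ?_
  cases T with
  | zero =>
    exact Real.log_nonpos (one_div_pos.2 hcard).le
      (div_le_one_of_le₀ (Nat.one_le_cast.2 Fintype.card_pos) hcard.le)
  | succ n =>
    exact Real.log_nonpos (post_nonneg hMo0 (hνprob _ _).1 _ _ _)
      (post_le_one hMo0 (hνprob _ _).1 _ _ _)
end

section
/- A constructive minimax theorem for minimax solutions: let X be a nonempty convex compact subset of a real topological vector space, Y a nonempty convex compact subset of a real topological vector space, and ψ : X×Y → ℝ a function such that for every y ∈ Y the map x ↦ ψ(x,y) is strictly convex and continuous (hence has a unique minimizer x_y over X), and for every x ∈ X the map y ↦ ψ(x,y) is concave and continuous. If ȳ ∈ Y maximizes y ↦ ψ(x_y, y) over Y, then (x_{ȳ}, ȳ) is a saddle point, i.e. ψ(x_{ȳ}, y) ≤ ψ(x_{ȳ}, ȳ) ≤ ψ(x, ȳ) for all x ∈ X and y ∈ Y; in particular x_{ȳ} attains min_{x∈X} sup_{y∈Y} ψ(x,y), and sup_{y∈Y} inf_{x∈X} ψ(x,y) = inf_{x∈X} sup_{y∈Y} ψ(x,y).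 -/
/-- If `x̄` is the unique minimizer of `f` on a compact set, then any family `u t`, `t ∈ (0, 1)`, with
`g (u t) ≤ v` and `(1 - t) * f (u t) + t * g (u t) ≤ v`, where `v = f x̄`, forces `g x̄ ≤ v`. -/
theorem IsCompact.le_of_unique_min_of_perturbed_le {E : Type*} [TopologicalSpace E] {X : Set E}
    (hX : IsCompact X) {f g : E → ℝ} (hf : ContinuousOn f X) (hg : ContinuousOn g X)
    {xbar : E} (hxbar : xbar ∈ X)
    (huniq : ∀ x ∈ X, f x ≤ f xbar → x = xbar)
    {u : ℝ → E} (hu : ∀ t ∈ Set.Ioo (0 : ℝ) 1, u t ∈ X)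
    (hgu : ∀ t ∈ Set.Ioo (0 : ℝ) 1, g (u t) ≤ f xbar)
    (hfgu : ∀ t ∈ Set.Ioo (0 : ℝ) 1, (1 - t) * f (u t) + t * g (u t) ≤ f xbar) :
    g xbar ≤ f xbar := by
  by_contra! hlt
  obtain ⟨xmin, hxmin, hmin⟩ := hX.exists_isMinOn ⟨xbar, hxbar⟩ (hf.sup hg)
  obtain ⟨xg, -, hxg⟩ := hX.exists_isMinOn ⟨xbar, hxbar⟩ hg
  have hpos : f xbar < max (f xmin) (g xmin) := by
    by_contra! hle
    obtain rfl := huniq xmin hxmin ((le_max_left _ _).trans hle)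
    exact absurd ((le_max_right _ _).trans hle) hlt.not_ge
  obtain ⟨δ, hδ, hδmax⟩ : ∃ δ > 0, max (f xmin) (g xmin) = f xbar + δ :=
    ⟨_, sub_pos.2 hpos, by ring⟩
  set A := |f xbar + δ - g xg|
  have hA : 0 ≤ A := abs_nonneg _
  set t := δ / (A + δ + 1)
  have hden : 0 < A + δ + 1 := by positivity
  have htmul : t * (A + δ + 1) = δ := div_mul_cancel₀ _ hden.ne'
  have ht0 : 0 < t := by positivity
  have ht1 : t < 1 := (div_lt_one hden).2 (by linarith)
  have htI : t ∈ Set.Ioo (0 : ℝ) 1 := ⟨ht0, ht1⟩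
  have hmax : f xbar + δ ≤ max (f (u t)) (g (u t)) := hδmax ▸ hmin (hu t htI)
  have hfu : f xbar + δ ≤ f (u t) := by
    rcases le_max_iff.1 hmax with h | h
    · exact h
    · linarith [hgu t htI]
  have hgm : g xg ≤ g (u t) := hxg (hu t htI)
  have h1 := mul_le_mul_of_nonneg_left hfu (sub_nonneg.2 ht1.le)
  have h2 := mul_le_mul_of_nonneg_left hgm ht0.le
  have h3 := mul_le_mul_of_nonneg_left (le_abs_self (f xbar + δ - g xg)) ht0.le
  have h4 := mul_pos ht0 hδ
  have h5 := hfgu t htI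
  change _ ≤ t * A at h3
  nlinarith


/-- A constructive minimax theorem for minimax solutions: if for each `y ∈ Y` the map
`x ↦ ψ(x,y)` has minimizer `x_y` over the compact convex set `X` (unique by strict
convexity), and `ȳ` maximizes `y ↦ ψ(x_y,y)` over the compact convex set `Y`, then
`(x_ȳ, ȳ)` is a saddle point; in particular `x_ȳ` attains `min_x sup_y ψ(x,y)` and
`sup_y inf_x ψ(x,y) = inf_x sup_y ψ(x,y)`. -/
theorem constructive_minimax
    {E F : Type*} [AddCommGroup E] [Module ℝ E] [TopologicalSpace E]
    [AddCommGroup F] [Module ℝ F] [TopologicalSpace F]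
    {X : Set E} {Y : Set F} (hXne : X.Nonempty) (hYne : Y.Nonempty)
    (hXconv : Convex ℝ X) (hXcomp : IsCompact X)
    (hYconv : Convex ℝ Y) (hYcomp : IsCompact Y)
    (ψ : E → F → ℝ)
    (hstrict : ∀ y ∈ Y, StrictConvexOn ℝ X fun x => ψ x y)
    (hcontx : ∀ y ∈ Y, ContinuousOn (fun x => ψ x y) X)
    (hconc : ∀ x ∈ X, ConcaveOn ℝ Y (ψ x))
    (hconty : ∀ x ∈ X, ContinuousOn (ψ x) Y)
    (xsel : F → E)
    (hxsel_mem : ∀ y ∈ Y, xsel y ∈ X)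
    (hxsel_min : ∀ y ∈ Y, ∀ x ∈ X, ψ (xsel y) y ≤ ψ x y)
    (ybar : F) (hybar : ybar ∈ Y)
    (hymax : ∀ y ∈ Y, ψ (xsel y) y ≤ ψ (xsel ybar) ybar) :
    ((∀ y ∈ Y, ψ (xsel ybar) y ≤ ψ (xsel ybar) ybar) ∧
        ∀ x ∈ X, ψ (xsel ybar) ybar ≤ ψ x ybar) ∧
    sSup ((fun y => ψ (xsel ybar) y) '' Y)
      = sInf ((fun x => sSup ((fun y => ψ x y) '' Y)) '' X) ∧
    sSup ((fun y => sInf ((fun x => ψ x y) '' X)) '' Y)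
      = sInf ((fun x => sSup ((fun y => ψ x y) '' Y)) '' X) := by
  have hxbar := hxsel_mem ybar hybar
  have hmin := hxsel_min ybar hybar
  have hsaddle : ∀ y ∈ Y, ψ (xsel ybar) y ≤ ψ (xsel ybar) ybar := by
    intro y hy
    have huniq : ∀ x ∈ X, ψ x ybar ≤ ψ (xsel ybar) ybar → x = xsel ybar := fun x hx hle =>
      (hstrict ybar hybar).eq_of_isMinOn (fun z hz => hle.trans (hmin z hz)) hmin hx hxbar
    have hYt : ∀ t ∈ Set.Ioo (0 : ℝ) 1, (1 - t) • ybar + t • y ∈ Y := fun t ht =>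
      hYconv hybar hy (sub_nonneg.2 ht.2.le) ht.1.le (by ring)
    have hconc_le : ∀ t ∈ Set.Ioo (0 : ℝ) 1,
        (1 - t) * ψ (xsel ((1 - t) • ybar + t • y)) ybar
          + t * ψ (xsel ((1 - t) • ybar + t • y)) y ≤ ψ (xsel ybar) ybar := fun t ht =>
      ((hconc _ (hxsel_mem _ (hYt t ht))).2 hybar hy (sub_nonneg.2 ht.2.le) ht.1.le
        (by ring)).trans (hymax _ (hYt t ht))
    refine hXcomp.le_of_unique_min_of_perturbed_le (f := fun x => ψ x ybar) (g := fun x => ψ x y)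
      (u := fun t => xsel ((1 - t) • ybar + t • y)) (hcontx ybar hybar) (hcontx y hy) hxbar huniq
      (fun t ht => hxsel_mem _ (hYt t ht)) (fun t ht => ?_) hconc_le
    have h1 := mul_le_mul_of_nonneg_left (hmin _ (hxsel_mem _ (hYt t ht))) (sub_nonneg.2 ht.2.le)
    refine le_of_mul_le_mul_left ?_ ht.1
    linarith [hconc_le t ht]
  have hsup : sSup ((fun y => ψ (xsel ybar) y) '' Y) = ψ (xsel ybar) ybar :=
    IsGreatest.csSup_eq ⟨⟨ybar, hybar, rfl⟩, Set.forall_mem_image.2 hsaddle⟩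
  have hinfsup : sInf ((fun x => sSup ((fun y => ψ x y) '' Y)) '' X) = ψ (xsel ybar) ybar :=
    IsLeast.csInf_eq ⟨⟨_, hxbar, hsup⟩, Set.forall_mem_image.2 fun x hx => (hmin x hx).trans
      (le_csSup (hYcomp.bddAbove_image (hconty x hx)) ⟨ybar, hybar, rfl⟩)⟩
  have hinf : ∀ y ∈ Y, sInf ((fun x => ψ x y) '' X) = ψ (xsel y) y := fun y hy =>
    IsLeast.csInf_eq ⟨⟨_, hxsel_mem y hy, rfl⟩, Set.forall_mem_image.2 (hxsel_min y hy)⟩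
  have hsupinf : sSup ((fun y => sInf ((fun x => ψ x y) '' X)) '' Y) = ψ (xsel ybar) ybar :=
    IsGreatest.csSup_eq ⟨⟨ybar, hybar, hinf ybar hybar⟩,
      Set.forall_mem_image.2 fun y hy => (hinf y hy).trans_le (hymax y hy)⟩
  exact ⟨⟨hsaddle, hmin⟩, hsup.trans hinfsup.symm, hsupinf.trans hinfsup.symm⟩
end

section
/- Identity for an arbitrary algorithmic belief and any environment: let η > 0, let q ∈ Δ(Π) have all coordinates positive, let p ∈ Δ(Π), and let ν̂ ∈ Δ(𝓜×Π) have all coordinates strictly positive; assume moreover that for every π with p(π) > 0 and every o ∈ O there exists M' ∈ 𝓜 with [M'(π)](o) > 0. Let G be the function defined on strictly positive vectors ν ∈ (0,∞)^{𝓜×Π} by the AIR formula (with posteriors given by the same Bayes formula). Then G is differentiable at ν̂, and for every M ∈ 𝓜 and π̄ ∈ Π: Σ_{π,o} p(π)·[M(π)](o)·( f_M(π̄) − f_M(π) − (1/η)·log( ν̂_{π*|π,o}(π̄) / q(π̄) ) ) = AIR_{q,η}(p,ν̂) + Σ_{(M',π̄') ∈ 𝓜×Π} (∂G/∂ν(M',π̄'))(ν̂)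 · ( 1[(M',π̄') = (M,π̄)] − ν̂(M',π̄') ). -/
open Finset

/-- The gradient of the relative entropy `Σ i, a i * log (a i / (Σ j, a j) / q i)` of a normalized
family of linear forms: differentiating the logarithms contributes nothing. -/
theorem hasFDerivAt_sum_mul_log_div_sum {ι E : Type*} [Fintype ι] [Nonempty ι]
    [NormedAddCommGroup E] [NormedSpace ℝ E] (a : ι → E →L[ℝ] ℝ) (q : ι → ℝ)
    (hq : ∀ i, 0 < q i) (v : E) (ha : ∀ i, 0 < a i v) :
    HasFDerivAt (fun w => ∑ i, a i w * Real.log (a i w / (∑ j, a j w) / q i))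
      (∑ i, Real.log (a i v / (∑ j, a j v) / q i) • a i) v := by
  have hs : 0 < ∑ j, a j v := Finset.sum_pos (fun i _ => ha i) Finset.univ_nonempty
  have hsd : HasFDerivAt (fun w => ∑ j, a j w) (∑ j, a j) v :=
    HasFDerivAt.fun_sum fun j _ => (a j).hasFDerivAt
  have hterm : ∀ i, HasFDerivAt (fun w => a i w * Real.log (a i w / (∑ j, a j w) / q i))
      (Real.log (a i v / (∑ j, a j v) / q i) • a i
        + (a i - (a i v / ∑ j, a j v) • ∑ j, a j)) v := by
    intro i
    have hlog : HasFDerivAt (fun w => Real.log (a i w) - Real.log (∑ j, a j w) - Real.log (q i))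
        ((a i v)⁻¹ • a i - (∑ j, a j v)⁻¹ • ∑ j, a j) v :=
      (((a i).hasFDerivAt.log (ha i).ne').sub (hsd.log hs.ne')).sub_const _
    have heq : (fun w => Real.log (a i w / (∑ j, a j w) / q i)) =ᶠ[nhds v]
        fun w => Real.log (a i w) - Real.log (∑ j, a j w) - Real.log (q i) := by
      filter_upwards [(a i).continuous.continuousAt.eventually_ne (ha i).ne',
        hsd.continuousAt.eventually_ne hs.ne'] with w hw hw'
      rw [Real.log_div (div_ne_zero hw hw') (hq i).ne', Real.log_div hw hw']
    refine ((a i).hasFDerivAt.mul (hlog.congr_of_eventuallyEq heq)).congr_fderiv ?_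
    rw [smul_sub, smul_smul, smul_smul, mul_inv_cancel₀ (ha i).ne', one_smul, ← div_eq_mul_inv,
      add_comm]
  refine (HasFDerivAt.fun_sum fun i _ => hterm i).congr_fderiv ?_
  rw [Finset.sum_add_distrib, Finset.sum_sub_distrib, ← Finset.sum_smul, ← Finset.sum_div,
    div_self hs.ne', one_smul, sub_self, add_zero]

/-- The unnormalized posterior mass of the decision `π'` given `(π, o)`, as a linear form in the
belief. -/
noncomputable def postMass {M P O : Type*} [Fintype M] (Mo : M → P → O → ℝ) (π : P)
    (o : O) (π' : P) : (M × P → ℝ) →L[ℝ] ℝ :=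
  ∑ m, Mo m π o • ContinuousLinearMap.proj (m, π')

theorem postMass_apply {M P O : Type*} [Fintype M] (Mo : M → P → O → ℝ) (π : P) (o : O) (π' : P)
    (ν : M × P → ℝ) :
    postMass Mo π o π' ν = ∑ m, ν (m, π') * Mo m π o := by
  simp [postMass, mul_comm]

theorem sum_postMass_mul {M P O : Type*} [Fintype M] [Fintype P] (Mo : M → P → O → ℝ) (π : P)
    (o : O) (ν : M × P → ℝ) (g : P → ℝ) :
    ∑ π', postMass Mo π o π' ν * g π' = ∑ x : M × P, ν x * Mo x.1 π o * g x.2 := by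
  rw [Fintype.sum_prod_type_right]
  simp only [postMass_apply, Finset.sum_mul]

section AIR

variable {M P O : Type*} [Fintype M] [Fintype P] [Fintype O]

theorem mObs_eq_sum_postMass (Mo : M → P → O → ℝ) (ν : M × P → ℝ) (π : P) (o : O) :
    mObs Mo ν π o = ∑ π', postMass Mo π o π' ν := by
  simpa [mObs] using (sum_postMass_mul Mo π o ν 1).symm

theorem post_eq_postMass_div (Mo : M → P → O → ℝ) (ν : M × P → ℝ) (π : P) (o : O) (π' : P) :
    post Mo ν π o π' = postMass Mo π o π' ν / ∑ j, postMass Mo π o j ν := by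
  rw [post, ← mObs_eq_sum_postMass, postMass_apply]

theorem mObs_mul_KLr_post (Mo : M → P → O → ℝ) (q : P → ℝ) (ν : M × P → ℝ) (π : P) (o : O) :
    mObs Mo ν π o * KLr (post Mo ν π o) q =
      ∑ π', postMass Mo π o π' ν * Real.log (post Mo ν π o π' / q π') := by
  rw [KLr, Finset.mul_sum]
  refine Finset.sum_congr rfl fun π' _ => ?_
  by_cases h : mObs Mo ν π o = 0
  · simp [post, h]
  · rw [← mul_assoc, post_eq_postMass_div, ← mObs_eq_sum_postMass, mul_div_cancel₀ _ h]

theorem AIR_eq_sum_postMass (Mo : M → P → O → ℝ) (f : M → P → ℝ) (q p : P → ℝ) (η : ℝ)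
    (ν : M × P → ℝ) :
    AIR Mo f q p η ν = ∑ π, ∑ o, p π *
      (∑ x : M × P, ν x * (Mo x.1 π o * (f x.1 x.2 - f x.1 π)) -
        (1 / η) * ∑ π', postMass Mo π o π' ν *
          Real.log (postMass Mo π o π' ν / (∑ j, postMass Mo π o j ν) / q π')) := by
  rw [AIR, Finset.sum_comm]
  refine Finset.sum_congr rfl fun π _ => ?_
  rw [Finset.sum_comm]
  refine Finset.sum_congr rfl fun o _ => ?_
  simp only [← post_eq_postMass_div]
  rw [← mObs_mul_KLr_post, mObs, mul_sub, Finset.mul_sum, Finset.sum_mul, Finset.mul_sum,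
    Finset.mul_sum, ← Finset.sum_sub_distrib]
  exact Finset.sum_congr rfl fun x _ => by ring

/-- The expected regret, net of the scaled log-likelihood ratio of the posterior, of the environment
`x.1` against the comparator `x.2`. -/
noncomputable def envScore (Mo : M → P → O → ℝ) (f : M → P → ℝ) (q p : P → ℝ) (η : ℝ)
    (ν : M × P → ℝ) (x : M × P) : ℝ :=
  ∑ π, ∑ o, p π * Mo x.1 π o *
    (f x.1 x.2 - f x.1 π - (1 / η) * Real.log (post Mo ν π o x.2 / q x.2))

theorem sum_mul_envScore (Mo : M → P → O → ℝ) (f : M → P → ℝ) (q p : P → ℝ) (η : ℝ)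
    (ν w : M × P → ℝ) :
    ∑ x, w x * envScore Mo f q p η ν x = ∑ π, ∑ o, p π *
      (∑ x : M × P, w x * (Mo x.1 π o * (f x.1 x.2 - f x.1 π)) -
        (1 / η) * ∑ π', postMass Mo π o π' w * Real.log (post Mo ν π o π' / q π')) := by
  simp only [envScore, Finset.mul_sum]
  rw [Finset.sum_comm]
  refine Finset.sum_congr rfl fun π _ => ?_
  rw [Finset.sum_comm]
  refine Finset.sum_congr rfl fun o _ => ?_
  rw [← Finset.mul_sum, sum_postMass_mul Mo π o w fun π' => Real.log (post Mo ν π o π' / q π'),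
    mul_sub, Finset.mul_sum, Finset.mul_sum, Finset.mul_sum, ← Finset.sum_sub_distrib]
  exact Finset.sum_congr rfl fun x _ => by ring

theorem AIR_eq_sum_mul_envScore (Mo : M → P → O → ℝ) (f : M → P → ℝ) (q p : P → ℝ) (η : ℝ)
    (ν : M × P → ℝ) :
    AIR Mo f q p η ν = ∑ x, ν x * envScore Mo f q p η ν x := by
  simp only [sum_mul_envScore, AIR_eq_sum_postMass, post_eq_postMass_div]

theorem hasFDerivAt_AIR [Nonempty P] (Mo : M → P → O → ℝ) (f : M → P → ℝ) (q p : P → ℝ) (η : ℝ)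
    (hq : ∀ π, 0 < q π) (ν : M × P → ℝ)
    (hpos : ∀ π, p π ≠ 0 → ∀ o π', 0 < postMass Mo π o π' ν) :
    HasFDerivAt (AIR Mo f q p η)
      (∑ x, envScore Mo f q p η ν x • ContinuousLinearMap.proj (R := ℝ) (φ := fun _ => ℝ) x) ν := by
  have hterm : ∀ π o, HasFDerivAt (fun w : M × P → ℝ => p π *
      (∑ x : M × P, w x * (Mo x.1 π o * (f x.1 x.2 - f x.1 π)) -
        (1 / η) * ∑ π', postMass Mo π o π' w *
          Real.log (postMass Mo π o π' w / (∑ j, postMass Mo π o j w) / q π')))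
      (p π • (∑ x : M × P, (Mo x.1 π o * (f x.1 x.2 - f x.1 π)) •
          ContinuousLinearMap.proj (R := ℝ) (φ := fun _ => ℝ) x -
        (1 / η) • ∑ π', Real.log (post Mo ν π o π' / q π') • postMass Mo π o π')) ν := by
    intro π o
    by_cases h : p π = 0
    · simpa [h] using hasFDerivAt_const (0 : ℝ) ν
    simp only [post_eq_postMass_div]
    refine HasFDerivAt.const_mul (.sub (HasFDerivAt.fun_sum fun x _ => ?_)
      ((hasFDerivAt_sum_mul_log_div_sum _ q hq ν (hpos π h o)).const_mul _)) _
    exact (hasFDerivAt_apply x ν).mul_const _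
  rw [funext (AIR_eq_sum_postMass Mo f q p η)]
  refine (HasFDerivAt.fun_sum fun π _ => HasFDerivAt.fun_sum fun o _ => hterm π o).congr_fderiv ?_
  ext w
  have h := sum_mul_envScore Mo f q p η ν w
  simp only [mul_comm (w _), mul_comm (postMass _ _ _ _ w)] at h
  simpa using h.symm

end AIR

/-- Identity for an arbitrary algorithmic belief and any environment: for a strictly
positive belief `ν̂ ∈ Δ(𝓜×Π)`, the function `G` given by the AIR formula on strictly
positive vectors is differentiable at `ν̂`, and for every environment `(M,π̄)`:
`Σ_{π,o} p(π)·[M(π)](o)·( f_M(π̄) − f_M(π) − (1/η)·log(ν̂_{π*|π,o}(π̄)/q(π̄)) )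
  = AIR_{q,η}(p,ν̂) + ⟨∇G(ν̂), 1(M,π̄) − ν̂⟩`. -/
theorem identity_arbitrary_belief
    {M P O : Type*} [Fintype M] [Nonempty M] [DecidableEq M]
    [Fintype P] [Nonempty P] [DecidableEq P]
    [Fintype O] [Nonempty O]
    (Mo : M → P → O → ℝ) (hMo : ∀ m π, IsProb (Mo m π))
    (f : M → P → ℝ) (η : ℝ) (hη : 0 < η)
    (q : P → ℝ) (hq : IsProb q) (hqpos : ∀ π, 0 < q π)
    (p : P → ℝ) (hp : IsProb p)
    (νh : M × P → ℝ) (hνh : IsProb νh) (hνhpos : ∀ x, 0 < νh x)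
    (hobs : ∀ π, 0 < p π → ∀ o : O, ∃ m' : M, 0 < Mo m' π o) :
    DifferentiableAt ℝ (AIR Mo f q p η) νh ∧
    ∀ (m : M) (πb : P),
      (∑ π, ∑ o, p π * Mo m π o *
          (f m πb - f m π - (1 / η) * Real.log (post Mo νh π o πb / q πb)))
        = AIR Mo f q p η νh
          + ∑ x : M × P, fderiv ℝ (AIR Mo f q p η) νh (Pi.single x 1) *
              ((if x = (m, πb) then 1 else 0) - νh x) := by
  have hpos : ∀ π, p π ≠ 0 → ∀ o π', 0 < postMass Mo π o π' νh := by
    intro π hπ o π'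
    obtain ⟨m', hm'⟩ := hobs π ((hp.1 π).lt_of_ne' hπ) o
    rw [postMass_apply]
    exact Finset.sum_pos' (fun m _ => mul_nonneg (hνhpos _).le ((hMo m π).1 o))
      ⟨m', Finset.mem_univ _, mul_pos (hνhpos _) hm'⟩
  have hderiv := hasFDerivAt_AIR Mo f q p η hqpos νh hpos
  refine ⟨hderiv.differentiableAt, fun m πb => ?_⟩
  have hgrad : ∀ x, fderiv ℝ (AIR Mo f q p η) νh (Pi.single x 1) = envScore Mo f q p η νh x := by
    intro x
    simp [hderiv.fderiv, Pi.single_apply]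
  change envScore Mo f q p η νh (m, πb) = _
  simp only [hgrad, mul_sub, Finset.sum_sub_distrib, mul_ite, mul_one, mul_zero,
    Finset.sum_ite_eq', Finset.mem_univ, if_true]
  simp only [AIR_eq_sum_mul_envScore, mul_comm (νh _), add_sub_cancel]
end
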